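/- Let p > 2 and q satisfy 2/p + 2/q = 1. There exists a constant C > 0 such that for every Schwartz function u₀ : ℝ² → ℂ, (∫_ℝ ‖I^{1/p} U_φ(t)u₀‖_{L^q(ℝ²)}^p dt)^{1/p} ≤ C ‖u₀‖_{L²(ℝ²)}, where U_φ(t)u₀ = ℱ⁻¹(e^{−itφ(ξ,η)} ℱu₀), φ(ξ,η) = ξ³ − 3ξη², and I^{σ}f = ℱ⁻¹(|(ξ,η)|^{σ} ℱf) with |(ξ,η)| = √(ξ² + η²). -/

import Mathlib

open MeasureTheory

/-- The Fourier transform on `ℝ²`. -/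
noncomputable def FT2 (f : ℝ × ℝ → ℂ) : ℝ × ℝ → ℂ :=
  fun w => ∫ v : ℝ × ℝ, Complex.exp (-Complex.I * (v.1 * w.1 + v.2 * w.2)) * f v

/-- The phase function of the linearized Novikov-Veselov equation. -/
def phiNV (ξ η : ℝ) : ℝ := ξ ^ 3 - 3 * ξ * η ^ 2

/-- `I^σ U_φ(t) u₀ = ℱ⁻¹(|(ξ,η)|^σ e^{−itφ} ℱu₀)`, the Riesz potential operator of
order `−σ` applied to the free evolution of the linearized Novikov-Veselov equation. -/
noncomputable def rieszUphi (σ : ℝ) (t : ℝ) (u₀ : ℝ × ℝ → ℂ) : ℝ × ℝ → ℂ :=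
  fun v => (2 * Real.pi : ℂ)⁻¹ ^ 2 *
    ∫ w : ℝ × ℝ, Complex.exp (Complex.I * (v.1 * w.1 + v.2 * w.2)
      - Complex.I * t * phiNV w.1 w.2) *
      (Real.sqrt (w.1 ^ 2 + w.2 ^ 2) ^ σ : ℝ) * FT2 u₀ w

namespace NovikovVeselov

open Set Filter Topology
open scoped ENNReal

/-- Van der Corput's first derivative test. -/
lemma norm_integral_exp_le_of_deriv_ge {P P' P'' : ℝ → ℝ} {a b μ : ℝ} (hab : a ≤ b) (hμ : 0 < μ)
    (hP : ∀ x ∈ Icc a b, HasDerivAt P (P' x) x) (hP' : ∀ x ∈ Icc a b, HasDerivAt P' (P'' x) x)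
    (hc : ContinuousOn P'' (Icc a b)) (hpos : ∀ x ∈ Icc a b, 0 ≤ P'' x) (ha : μ ≤ P' a) :
    ‖∫ x in a..b, Complex.exp (P x * Complex.I)‖ ≤ 2 / μ := by
  have hPc : ContinuousOn P (Icc a b) := fun x hx => (hP x hx).continuousAt.continuousWithinAt
  have hPc' : ContinuousOn P' (Icc a b) := fun x hx => (hP' x hx).continuousAt.continuousWithinAt
  have hmono : MonotoneOn P' (Icc a b) := by
    apply monotoneOn_of_deriv_nonneg (convex_Icc a b) hPc'
    · intro x hx
      exact (hP' x (interior_subset hx)).differentiableAt.differentiableWithinAt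
    · intro x hx
      rw [(hP' x (interior_subset hx)).deriv]
      exact hpos x (interior_subset hx)
  have hge : ∀ x ∈ Icc a b, μ ≤ P' x := fun x hx =>
    ha.trans (hmono (left_mem_Icc.2 hab) hx hx.1)
  have hne : ∀ x ∈ Icc a b, P' x ≠ 0 := fun x hx => (hμ.trans_le (hge x hx)).ne'
  have hneC : ∀ x ∈ Icc a b, (P' x : ℂ) ≠ 0 := fun x hx => by exact_mod_cast hne x hx
  have hI := Complex.I_ne_zero
  set E : ℝ → ℂ := fun x => Complex.exp (P x * Complex.I) with hE
  have hEc : ContinuousOn E (Icc a b) := by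
    apply Complex.continuous_exp.comp_continuousOn
    exact (Complex.continuous_ofReal.comp_continuousOn hPc).mul continuousOn_const
  have hnE : ∀ x, ‖E x‖ = 1 := fun x => Complex.norm_exp_ofReal_mul_I _
  set R : ℝ → ℂ := fun x => E x * (P'' x : ℂ) / (Complex.I * (P' x : ℂ) ^ 2) with hR
  have hRc : ContinuousOn R (Icc a b) := by
    apply ContinuousOn.div
    · exact hEc.mul (Complex.continuous_ofReal.comp_continuousOn hc)
    · exact continuousOn_const.mul ((Complex.continuous_ofReal.comp_continuousOn hPc').pow 2)
    · intro x hx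
      exact mul_ne_zero hI (pow_ne_zero _ (hneC x hx))
  have hder : ∀ x ∈ Icc a b, HasDerivAt (fun x => E x / (Complex.I * (P' x : ℂ)))
      (E x - R x) x := by
    intro x hx
    have h1 : HasDerivAt E (E x * (P' x * Complex.I)) x := by
      have := ((hP x hx).ofReal_comp.mul_const Complex.I).cexp
      simpa [hE] using this
    have h2 : HasDerivAt (fun x => Complex.I * (P' x : ℂ)) (Complex.I * (P'' x : ℂ)) x :=
      (hP' x hx).ofReal_comp.const_mul _
    refine (h1.div h2 (mul_ne_zero hI (hneC x hx))).congr_deriv ?_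
    have := hneC x hx
    simp only [hR]
    field_simp
  have hu : uIcc a b = Icc a b := uIcc_of_le hab
  have hEi : IntervalIntegrable E volume a b := ContinuousOn.intervalIntegrable (hu ▸ hEc)
  have hRi : IntervalIntegrable R volume a b := ContinuousOn.intervalIntegrable (hu ▸ hRc)
  have hint := intervalIntegral.integral_eq_sub_of_hasDerivAt (hu ▸ hder) (hEi.sub hRi)
  rw [intervalIntegral.integral_sub hEi hRi] at hint
  have hder2 : ∀ x ∈ Icc a b, HasDerivAt (fun x => -(P' x)⁻¹) (P'' x / P' x ^ 2) x := by
    intro x hx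
    have := ((hP' x hx).inv (hne x hx)).neg
    refine this.congr_deriv ?_
    ring
  have hc2 : ContinuousOn (fun x => P'' x / P' x ^ 2) (Icc a b) :=
    hc.div (hPc'.pow 2) (fun x hx => pow_ne_zero _ (hne x hx))
  have hint2 := intervalIntegral.integral_eq_sub_of_hasDerivAt (hu ▸ hder2)
    (ContinuousOn.intervalIntegrable (hu ▸ hc2))
  have hRn : ‖∫ x in a..b, R x‖ ≤ ∫ x in a..b, P'' x / P' x ^ 2 := by
    refine (intervalIntegral.norm_integral_le_integral_norm hab).trans (le_of_eq ?_)
    apply intervalIntegral.integral_congr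
    intro x hx
    rw [hu] at hx
    simp [hR, hnE, abs_of_nonneg (hpos x hx)]
  have hb := hge b (right_mem_Icc.2 hab)
  have hIb : ‖E b / (Complex.I * (P' b : ℂ))‖ = (P' b)⁻¹ := by
    simp [hnE, abs_of_pos (hμ.trans_le hb)]
  have hIa : ‖E a / (Complex.I * (P' a : ℂ))‖ = (P' a)⁻¹ := by
    simp [hnE, abs_of_pos (hμ.trans_le ha)]
  have heq : ∫ x in a..b, E x = (E b / (Complex.I * (P' b : ℂ)) - E a / (Complex.I * (P' a : ℂ)))
      + ∫ x in a..b, R x := by rw [← hint]; ring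
  have hia : (P' a)⁻¹ ≤ μ⁻¹ := inv_anti₀ hμ ha
  calc ‖∫ x in a..b, E x‖ ≤ ((P' b)⁻¹ + (P' a)⁻¹) + (-(P' b)⁻¹ - -(P' a)⁻¹) := by
        rw [heq]
        refine (norm_add_le _ _).trans (add_le_add ((norm_sub_le _ _).trans ?_) (hRn.trans hint2.le))
        rw [hIa, hIb]
    _ ≤ 2 / μ := by rw [div_eq_mul_inv]; linarith

lemma norm_integral_exp_le_of_deriv_nonneg {P P' P'' : ℝ → ℝ} {a b l : ℝ} (hab : a ≤ b) (hl : 0 < l)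
    (hP : ∀ x ∈ Icc a b, HasDerivAt P (P' x) x) (hP' : ∀ x ∈ Icc a b, HasDerivAt P' (P'' x) x)
    (hc : ContinuousOn P'' (Icc a b)) (hpos : ∀ x ∈ Icc a b, l ^ 2 ≤ P'' x) (ha : 0 ≤ P' a) :
    ‖∫ x in a..b, Complex.exp (P x * Complex.I)‖ ≤ 3 / l := by
  have htriv : ∀ c d : ℝ, c ≤ d → ‖∫ x in c..d, Complex.exp (P x * Complex.I)‖ ≤ d - c := by
    intro c d hcd
    have := intervalIntegral.norm_integral_le_of_norm_le_const (a := c) (b := d)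
      (f := fun x => Complex.exp (P x * Complex.I)) (C := 1)
      (fun x _ => (Complex.norm_exp_ofReal_mul_I _).le)
    rwa [one_mul, abs_of_nonneg (sub_nonneg.2 hcd)] at this
  have hdiv : 3 / l = 1 / l + 2 / l := by ring
  have h1l : 0 < 1 / l := by positivity
  rcases le_total b (a + 1 / l) with hb | hb
  · have h2l : 0 < 2 / l := by positivity
    linarith [htriv a b hab]
  set c := a + 1 / l with hcdef
  have hac : a ≤ c := by linarith
  have hPc : ContinuousOn P (Icc a b) := fun x hx => (hP x hx).continuousAt.continuousWithinAt
  have hPc' : ContinuousOn P' (Icc a b) := fun x hx => (hP' x hx).continuousAt.continuousWithinAt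
  have hsub : Icc c b ⊆ Icc a b := Icc_subset_Icc_left hac
  have hsub' : Icc a c ⊆ Icc a b := Icc_subset_Icc_right hb
  have hEc : ContinuousOn (fun x => Complex.exp (P x * Complex.I)) (Icc a b) := by
    apply Complex.continuous_exp.comp_continuousOn
    exact (Complex.continuous_ofReal.comp_continuousOn hPc).mul continuousOn_const
  have hPl : l ≤ P' c := by
    have hmv := (convex_Icc a b).mul_sub_le_image_sub_of_le_deriv hPc'
      (C := l ^ 2) (fun x hx => (hP' x (interior_subset hx)).differentiableAt.differentiableWithinAt)
      (fun x hx => by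
        rw [(hP' x (interior_subset hx)).deriv]
        exact hpos x (interior_subset hx)) a (left_mem_Icc.2 hab) c ⟨hac, hb⟩ hac
    have : l ^ 2 * (c - a) = l := by
      rw [hcdef]; field_simp; ring
    linarith
  have hright := norm_integral_exp_le_of_deriv_ge hb hl (fun x hx => hP x (hsub hx))
    (fun x hx => hP' x (hsub hx)) (hc.mono hsub)
    (fun x hx => (sq_nonneg l).trans (hpos x (hsub hx))) hPl
  rw [← intervalIntegral.integral_add_adjacent_intervals (b := c)
    (ContinuousOn.intervalIntegrable (by rw [uIcc_of_le hac]; exact hEc.mono hsub'))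
    (ContinuousOn.intervalIntegrable (by rw [uIcc_of_le hb]; exact hEc.mono hsub)), hdiv]
  refine (norm_add_le _ _).trans (add_le_add ((htriv a c hac).trans ?_) hright)
  rw [hcdef]; linarith

lemma norm_integral_exp_le_of_deriv_nonpos {P P' P'' : ℝ → ℝ} {a b l : ℝ} (hab : a ≤ b) (hl : 0 < l)
    (hP : ∀ x ∈ Icc a b, HasDerivAt P (P' x) x) (hP' : ∀ x ∈ Icc a b, HasDerivAt P' (P'' x) x)
    (hc : ContinuousOn P'' (Icc a b)) (hpos : ∀ x ∈ Icc a b, l ^ 2 ≤ P'' x) (hb : P' b ≤ 0) :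
    ‖∫ x in a..b, Complex.exp (P x * Complex.I)‖ ≤ 3 / l := by
  have hmem : ∀ x ∈ Icc (-b) (-a), -x ∈ Icc a b := fun x hx => ⟨by linarith [hx.2], by linarith [hx.1]⟩
  have := norm_integral_exp_le_of_deriv_nonneg (P := fun x => P (-x)) (P' := fun x => -P' (-x))
    (P'' := fun x => P'' (-x)) (neg_le_neg hab) hl
    (fun x hx => by
      have := (hP _ (hmem x hx)).comp x (hasDerivAt_neg x)
      simpa [Function.comp_def] using this)
    (fun x hx => by
      have := ((hP' _ (hmem x hx)).comp x (hasDerivAt_neg x)).fun_neg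
      simpa [Function.comp_def] using this)
    (hc.comp continuousOn_neg hmem) (fun x hx => hpos _ (hmem x hx)) (by simpa using hb)
  rwa [intervalIntegral.integral_comp_neg (fun x => Complex.exp (P x * Complex.I)), neg_neg,
    neg_neg] at this

/-- Van der Corput's second derivative test. -/
lemma norm_integral_exp_le_of_sq_le_deriv2 {P P' P'' : ℝ → ℝ} {a b l : ℝ} (hab : a ≤ b) (hl : 0 < l)
    (hP : ∀ x ∈ Icc a b, HasDerivAt P (P' x) x) (hP' : ∀ x ∈ Icc a b, HasDerivAt P' (P'' x) x)
    (hc : ContinuousOn P'' (Icc a b)) (hpos : ∀ x ∈ Icc a b, l ^ 2 ≤ P'' x) :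
    ‖∫ x in a..b, Complex.exp (P x * Complex.I)‖ ≤ 6 / l := by
  have h3 : 3 / l ≤ 6 / l := by gcongr; norm_num
  rcases le_total 0 (P' a) with ha | ha
  · exact (norm_integral_exp_le_of_deriv_nonneg hab hl hP hP' hc hpos ha).trans h3
  rcases le_total (P' b) 0 with hb | hb
  · exact (norm_integral_exp_le_of_deriv_nonpos hab hl hP hP' hc hpos hb).trans h3
  have hPc : ContinuousOn P (Icc a b) := fun x hx => (hP x hx).continuousAt.continuousWithinAt
  have hPc' : ContinuousOn P' (Icc a b) := fun x hx => (hP' x hx).continuousAt.continuousWithinAt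
  obtain ⟨c, hcm, hc0⟩ := intermediate_value_Icc hab hPc' ⟨ha, hb⟩
  have hsub : Icc c b ⊆ Icc a b := Icc_subset_Icc_left hcm.1
  have hsub' : Icc a c ⊆ Icc a b := Icc_subset_Icc_right hcm.2
  have hEc : ContinuousOn (fun x => Complex.exp (P x * Complex.I)) (Icc a b) := by
    apply Complex.continuous_exp.comp_continuousOn
    exact (Complex.continuous_ofReal.comp_continuousOn hPc).mul continuousOn_const
  rw [← intervalIntegral.integral_add_adjacent_intervals (b := c)
    (ContinuousOn.intervalIntegrable (by rw [uIcc_of_le hcm.1]; exact hEc.mono hsub'))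
    (ContinuousOn.intervalIntegrable (by rw [uIcc_of_le hcm.2]; exact hEc.mono hsub)),
    show 6 / l = 3 / l + 3 / l by ring]
  refine (norm_add_le _ _).trans (add_le_add ?_ ?_)
  · exact norm_integral_exp_le_of_deriv_nonpos hcm.1 hl (fun x hx => hP x (hsub' hx))
      (fun x hx => hP' x (hsub' hx)) (hc.mono hsub') (fun x hx => hpos x (hsub' hx)) hc0.le
  · exact norm_integral_exp_le_of_deriv_nonneg hcm.2 hl (fun x hx => hP x (hsub hx))
      (fun x hx => hP' x (hsub hx)) (hc.mono hsub) (fun x hx => hpos x (hsub hx)) hc0.ge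

/-- Van der Corput's second derivative test with an increasing amplitude. -/
lemma norm_integral_mul_exp_le {P P' P'' ψ ψ' : ℝ → ℝ} {a b l : ℝ} (hab : a ≤ b)
    (hl : 0 < l)
    (hP : ∀ x ∈ Icc a b, HasDerivAt P (P' x) x) (hP' : ∀ x ∈ Icc a b, HasDerivAt P' (P'' x) x)
    (hc : ContinuousOn P'' (Icc a b)) (hpos : ∀ x ∈ Icc a b, l ^ 2 ≤ P'' x)
    (hψ : ∀ x ∈ Icc a b, HasDerivAt ψ (ψ' x) x) (hψc : ContinuousOn ψ' (Icc a b))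
    (hψ' : ∀ x ∈ Icc a b, 0 ≤ ψ' x) (hψa : 0 ≤ ψ a) (hψb : ψ b ≤ 1) :
    ‖∫ x in a..b, (ψ x : ℂ) * Complex.exp (P x * Complex.I)‖ ≤ 12 / l := by
  have hPc : ContinuousOn P (Icc a b) := fun x hx => (hP x hx).continuousAt.continuousWithinAt
  set E : ℝ → ℂ := fun x => Complex.exp (P x * Complex.I) with hE
  have hEc : ContinuousOn E (Icc a b) := by
    apply Complex.continuous_exp.comp_continuousOn
    exact (Complex.continuous_ofReal.comp_continuousOn hPc).mul continuousOn_const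
  have hu : uIcc a b = Icc a b := uIcc_of_le hab
  have hEi : IntervalIntegrable E volume a b := ContinuousOn.intervalIntegrable (hu ▸ hEc)
  have hψi : IntervalIntegrable ψ' volume a b := ContinuousOn.intervalIntegrable (hu ▸ hψc)
  set F : ℝ → ℂ := fun x => ∫ s in a..x, E s with hF
  have hFb : ∀ x ∈ Icc a b, ‖F x‖ ≤ 6 / l := fun x hx => by
    have hs : Icc a x ⊆ Icc a b := Icc_subset_Icc_right hx.2
    exact norm_integral_exp_le_of_sq_le_deriv2 hx.1 hl (fun y hy => hP y (hs hy))
      (fun y hy => hP' y (hs hy)) (hc.mono hs) (fun y hy => hpos y (hs hy))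
  have hFa : F a = 0 := intervalIntegral.integral_same
  have hFc : ContinuousOn F (uIcc a b) :=
    intervalIntegral.continuousOn_primitive_interval' hEi left_mem_uIcc
  have hparts := intervalIntegral.integral_mul_deriv_eq_deriv_mul_of_hasDerivAt
    (u := fun x => (ψ x : ℂ)) (u' := fun x => (ψ' x : ℂ)) (v := F) (v' := E)
    (fun x hx => (hψ x (hu ▸ hx)).ofReal_comp.continuousAt.continuousWithinAt) hFc
    (fun x hx => by
      rw [min_eq_left hab, max_eq_right hab] at hx
      exact (hψ x (Ioo_subset_Icc_self hx)).ofReal_comp)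
    (fun x hx => by
      rw [min_eq_left hab, max_eq_right hab] at hx
      have hxi := Ioo_subset_Icc_self hx
      apply intervalIntegral.integral_hasDerivAt_right
      · refine hEi.mono_set ?_
        rw [hu, uIcc_of_le hx.1.le]
        exact Icc_subset_Icc_right hx.2.le
      · exact (hEc.mono Ioo_subset_Icc_self).stronglyMeasurableAtFilter isOpen_Ioo x hx
      · exact hEc.continuousAt (Icc_mem_nhds hx.1 hx.2))
    ⟨hψi.1.ofReal, hψi.2.ofReal⟩ hEi
  rw [hparts, hFa, mul_zero, sub_zero]
  have hI := intervalIntegral.integral_eq_sub_of_hasDerivAt (hu ▸ hψ) hψi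
  have h6 : 0 ≤ 6 / l := by positivity
  have hψm : 0 ≤ ∫ x in a..b, ψ' x := intervalIntegral.integral_nonneg hab hψ'
  have h2 : ‖∫ x in a..b, (ψ' x : ℂ) * F x‖ ≤ (ψ b - ψ a) * (6 / l) := by
    refine (intervalIntegral.norm_integral_le_integral_norm hab).trans ?_
    rw [← hI, ← intervalIntegral.integral_mul_const]
    have hFc' : ContinuousOn (fun x => ‖(ψ' x : ℂ) * F x‖) (uIcc a b) :=
      ((Complex.continuous_ofReal.comp_continuousOn (hu ▸ hψc)).mul hFc).norm
    apply intervalIntegral.integral_mono_on hab hFc'.intervalIntegrable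
      (hψi.mul_const _)
    intro x hx
    rw [norm_mul, Complex.norm_real, Real.norm_of_nonneg (hψ' x hx)]
    exact mul_le_mul_of_nonneg_left (hFb x hx) (hψ' x hx)
  have h1 : ‖(ψ b : ℂ) * F b‖ ≤ 1 * (6 / l) := by
    rw [norm_mul, Complex.norm_real, Real.norm_of_nonneg (by linarith)]
    exact mul_le_mul hψb (hFb b (right_mem_Icc.2 hab)) (norm_nonneg _) zero_le_one
  have h3 : (ψ b - ψ a) * (6 / l) ≤ 1 * (6 / l) := by gcongr; linarith
  have h4 : 12 / l = 1 * (6 / l) + 1 * (6 / l) := by ring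
  rw [h4]
  exact (norm_sub_le _ _).trans (add_le_add h1 (h2.trans h3))

/-- The phase of the plane wave of frequency `w` at time `t` and position `x`. -/
def phase (t : ℝ) (x w : ℂ) : ℝ := x.re * w.re + x.im * w.im - t * phiNV w.re w.im

/-- The plane wave of frequency `w` at time `t` and position `x`. -/
noncomputable def wave (t : ℝ) (x w : ℂ) : ℂ := Complex.exp (phase t x w * Complex.I)

/-- A frequency cutoff to the strip `1 / 2 ≤ re w ≤ 2`, with Gaussian decay in `im w`. -/
noncomputable def strip (w : ℂ) : ℝ :=
  (Icc (1 / 2 : ℝ) 2).indicator (fun ξ => √ξ * Real.exp (-(ξ * w.im ^ 2))) w.re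

lemma norm_integral_airy_le {s d x : ℝ} (hs : 0 < s) (hd : 0 ≤ d) :
    ‖∫ ξ in (1 / 2 : ℝ)..2, (Real.exp (-(d / ξ)) : ℂ) *
      Complex.exp ((x * ξ + s * ξ ^ 3 + 3 * s * d / ξ : ℝ) * Complex.I)‖ ≤ 12 / √(3 * s) := by
  have h0 : ∀ ξ ∈ Icc (1 / 2 : ℝ) 2, ξ ≠ 0 := fun ξ hξ => by
    have := hξ.1
    positivity
  apply norm_integral_mul_exp_le (P' := fun ξ => x + 3 * s * ξ ^ 2 - 3 * s * d / ξ ^ 2)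
    (P'' := fun ξ => 6 * s * ξ + 6 * s * d / ξ ^ 3)
    (ψ' := fun ξ => Real.exp (-(d / ξ)) * (d / ξ ^ 2)) (by norm_num) (by positivity)
  · intro ξ hξ
    have hne := h0 ξ hξ
    have := (((hasDerivAt_id ξ).const_mul x).add ((hasDerivAt_pow 3 ξ).const_mul s)).add
      ((hasDerivAt_inv hne).const_mul (3 * s * d))
    refine (this.congr_deriv ?_).congr_of_eventuallyEq (Filter.Eventually.of_forall fun y => ?_)
    · simp only [Nat.cast_ofNat]; field_simp; ring
    · simp [div_eq_mul_inv]
  · intro ξ hξ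
    have hne := h0 ξ hξ
    have := ((hasDerivAt_const ξ x).add ((hasDerivAt_pow 2 ξ).const_mul (3 * s))).sub
      (((hasDerivAt_pow 2 ξ).inv (pow_ne_zero 2 hne)).const_mul (3 * s * d))
    refine (this.congr_deriv ?_).congr_of_eventuallyEq (Filter.Eventually.of_forall fun y => ?_)
    · simp only [Nat.cast_ofNat]; field_simp; ring
    · simp [div_eq_mul_inv]
  · apply ContinuousOn.add (by fun_prop)
    exact continuousOn_const.div (by fun_prop) (fun ξ hξ => pow_ne_zero _ (h0 ξ hξ))
  · intro ξ hξ
    rw [Real.sq_sqrt (by positivity)]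
    have h1 := hξ.1
    have : 0 ≤ 6 * s * d / ξ ^ 3 := by positivity
    nlinarith
  · intro ξ hξ
    have hne := h0 ξ hξ
    have := (((hasDerivAt_inv hne).const_mul d).neg).exp
    refine (this.congr_deriv ?_).congr_of_eventuallyEq (Filter.Eventually.of_forall fun y => ?_)
    · simp [div_eq_mul_inv]
    · simp [div_eq_mul_inv]
  · apply ContinuousOn.mul
    · apply Real.continuous_exp.comp_continuousOn
      exact (continuousOn_const.div continuousOn_id h0).neg
    · exact continuousOn_const.div (by fun_prop) (fun ξ hξ => pow_ne_zero _ (h0 ξ hξ))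
  · intro ξ _
    positivity
  · positivity
  · rw [Real.exp_le_one_iff]
    linarith [show 0 ≤ d / 2 by positivity]

lemma norm_integral_airy_le_abs {t d x : ℝ} (ht : t ≠ 0) (hd : 0 ≤ d) :
    ‖∫ ξ in (1 / 2 : ℝ)..2, (Real.exp (-(d / ξ)) : ℂ) *
      Complex.exp ((x * ξ - t * ξ ^ 3 - 3 * t * d / ξ : ℝ) * Complex.I)‖ ≤ 12 / √(3 * |t|) := by
  rcases ht.lt_or_gt with h | h
  · rw [abs_of_neg h]
    convert norm_integral_airy_le (x := x) (neg_pos.2 h) hd using 8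
    ring
  · rw [abs_of_pos h, ← Complex.norm_conj, intervalIntegral.integral_of_le (by norm_num),
      ← integral_conj, ← intervalIntegral.integral_of_le (by norm_num)]
    refine le_of_eq_of_le (congrArg norm (intervalIntegral.integral_congr fun ξ _ => ?_))
      (norm_integral_airy_le (x := -x) h hd)
    rw [map_mul, Complex.conj_ofReal, ← Complex.exp_conj, map_mul, Complex.conj_ofReal,
      Complex.conj_I]
    congr 2
    push_cast
    ring

lemma strip_nonneg (w : ℂ) : 0 ≤ strip w := by
  unfold strip
  exact indicator_nonneg (fun ξ _ => by positivity) _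

lemma measurable_strip : Measurable strip := by
  have : strip = (Complex.re ⁻¹' Icc (1 / 2 : ℝ) 2).indicator
      (fun w => √w.re * Real.exp (-(w.re * w.im ^ 2))) := by
    ext w; simp [strip, indicator]
  rw [this]
  exact Measurable.indicator (by fun_prop) (Complex.measurable_re measurableSet_Icc)

lemma strip_le_prod (w : ℂ) :
    strip w ≤ (Icc (1 / 2 : ℝ) 2).indicator (fun _ => 2) w.re * Real.exp (-(1 / 2) * w.im ^ 2) := by
  unfold strip
  by_cases h : w.re ∈ Icc (1 / 2 : ℝ) 2
  · rw [indicator_of_mem h, indicator_of_mem h]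
    have h1 : √w.re ≤ 2 := by
      rw [Real.sqrt_le_left (by norm_num)]
      linarith [h.2]
    gcongr
    nlinarith [h.1, sq_nonneg w.im]
  · rw [indicator_of_notMem h, indicator_of_notMem h, zero_mul]

lemma strip_le (w : ℂ) : strip w ≤ 2 := by
  refine (strip_le_prod w).trans ?_
  have h1 : (Icc (1 / 2 : ℝ) 2).indicator (fun _ => (2 : ℝ)) w.re ≤ 2 :=
    indicator_le_self' (fun _ _ => by norm_num) _
  have h2 : Real.exp (-(1 / 2) * w.im ^ 2) ≤ 1 := by
    rw [Real.exp_le_one_iff]; nlinarith [sq_nonneg w.im]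
  have h3 := indicator_nonneg (s := Icc (1 / 2 : ℝ) 2) (f := fun _ => (2 : ℝ))
    (fun _ _ => by norm_num) w.re
  nlinarith [Real.exp_pos (-(1 / 2) * w.im ^ 2)]

lemma integrable_strip : Integrable strip := by
  have h : Integrable (fun z : ℝ × ℝ => (Icc (1 / 2 : ℝ) 2).indicator (fun _ => (2 : ℝ)) z.1 *
      Real.exp (-(1 / 2) * z.2 ^ 2)) (volume.prod volume) := by
    apply Integrable.mul_prod (f := (Icc (1 / 2 : ℝ) 2).indicator (fun _ => (2 : ℝ)))
      (g := fun y => Real.exp (-(1 / 2) * y ^ 2))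
    · rw [integrable_indicator_iff measurableSet_Icc]
      exact integrableOn_const (by simp)
    · exact integrable_exp_neg_mul_sq (by norm_num)
  have h' := (Complex.volume_preserving_equiv_real_prod.integrable_comp_emb
    Complex.measurableEquivRealProd.measurableEmbedding).2 h
  refine h'.mono' measurable_strip.aestronglyMeasurable (Filter.Eventually.of_forall fun w => ?_)
  rw [Real.norm_of_nonneg (strip_nonneg w)]
  exact strip_le_prod w

lemma continuous_phase : Continuous (fun z : ℝ × ℂ × ℂ => phase z.1 z.2.1 z.2.2) := by
  unfold phase phiNV
  fun_prop

lemma continuous_wave : Continuous (fun z : ℝ × ℂ × ℂ => wave z.1 z.2.1 z.2.2) := by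
  unfold wave
  have := continuous_phase
  fun_prop

lemma norm_wave (t : ℝ) (x w : ℂ) : ‖wave t x w‖ = 1 := Complex.norm_exp_ofReal_mul_I _

lemma integral_exp_gaussian (t y : ℝ) {ξ : ℝ} (hξ : 0 < ξ) :
    (√ξ : ℂ) * ∫ η : ℝ, Complex.exp ((y * η + 3 * t * ξ * η ^ 2 : ℝ) * Complex.I) *
      Real.exp (-(ξ * η ^ 2)) =
    ((Real.pi : ℂ) / (1 - 3 * t * Complex.I)) ^ (1 / 2 : ℂ) *
      (Real.exp (-(y ^ 2 / (4 * (1 + 9 * t ^ 2)) / ξ)) *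
      Complex.exp ((-(3 * t * (y ^ 2 / (4 * (1 + 9 * t ^ 2))) / ξ) : ℝ) * Complex.I)) := by
  set z : ℂ := 1 - 3 * t * Complex.I with hz
  have hzre : z.re = 1 := by simp [hz]
  have hz0 : z ≠ 0 := fun h => by simp [h] at hzre
  have hξ0 : (ξ : ℂ) ≠ 0 := by exact_mod_cast hξ.ne'
  have h := integral_cexp_quadratic (b := -(ξ * z)) (by simp [hzre, hξ]) (y * Complex.I) 0
  have hint : ∀ η : ℝ, Complex.exp ((y * η + 3 * t * ξ * η ^ 2 : ℝ) * Complex.I) *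
      Real.exp (-(ξ * η ^ 2)) = Complex.exp (-(ξ * z) * η ^ 2 + y * Complex.I * η + 0) := by
    intro η
    rw [Complex.ofReal_exp, ← Complex.exp_add]
    congr 1
    rw [hz]; push_cast; ring
  simp_rw [hint]
  rw [h, neg_neg]
  have hsplit : ((Real.pi : ℂ) / (ξ * z)) ^ (1 / 2 : ℂ) =
      (√ξ : ℂ)⁻¹ * ((Real.pi : ℂ) / z) ^ (1 / 2 : ℂ) := by
    have : (Real.pi : ℂ) / (ξ * z) = ((ξ⁻¹ : ℝ) : ℂ) * (Real.pi / z) := by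
      push_cast; field_simp
    have hpz : (Real.pi : ℂ) / z ≠ 0 := div_ne_zero (by exact_mod_cast Real.pi_ne_zero) hz0
    have hinv : ((ξ⁻¹ : ℝ) : ℂ) ≠ 0 := by exact_mod_cast (inv_pos.2 hξ).ne'
    rw [this, Complex.cpow_def_of_ne_zero (mul_ne_zero hinv hpz),
      Complex.log_ofReal_mul (inv_pos.2 hξ) hpz, add_mul, Complex.exp_add,
      ← Complex.cpow_def_of_ne_zero hpz]
    congr 1
    rw [Real.log_inv, ← Complex.ofReal_inv, ← Real.sqrt_inv, Real.sqrt_eq_rpow,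
      Real.rpow_def_of_pos (inv_pos.2 hξ), Real.log_inv]
    push_cast; rfl
  have hs : (√ξ : ℂ) ≠ 0 := by exact_mod_cast (Real.sqrt_pos.2 hξ).ne'
  rw [hsplit, ← mul_assoc, ← mul_assoc, mul_inv_cancel₀ hs, one_mul]
  congr 1
  rw [Complex.ofReal_exp, ← Complex.exp_add]
  congr 1
  have hw : (1 : ℂ) + 9 * t ^ 2 = z * (1 + 3 * t * Complex.I) := by
    rw [hz]; linear_combination (9 * t ^ 2 : ℂ) * Complex.I_sq
  have hw0 : (1 : ℂ) + 9 * t ^ 2 ≠ 0 := by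
    have : (1 + 9 * t ^ 2 : ℝ) ≠ 0 := by positivity
    exact_mod_cast this
  push_cast
  have hI := Complex.I_sq
  have e1 : 0 - (↑y * Complex.I) ^ 2 / (4 * -(↑ξ * z)) = -(y ^ 2 / (4 * ξ * z)) := by
    field_simp
    rw [hI]; ring
  rw [e1]
  have e2 : (y : ℂ) ^ 2 / (4 * ξ * z) =
     (y : ℂ) ^ 2 * (1 + 3 * t * Complex.I) / (4 * ξ * (1 + 9 * t ^ 2)) := by
    rw [div_eq_div_iff (by simp [hξ0, hz0]) (by simp [hξ0, hw0]), hw]; ring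
  rw [e2]
  field_simp
  ring

lemma norm_cpow_half_le {t : ℝ} (ht : t ≠ 0) :
    ‖((Real.pi : ℂ) / (1 - 3 * t * Complex.I)) ^ (1 / 2 : ℂ)‖ ≤ √(Real.pi / (3 * |t|)) := by
  set z : ℂ := 1 - 3 * t * Complex.I with hz
  have hzre : z.re = 1 := by simp [hz]
  have hz0 : z ≠ 0 := fun h => by simp [h] at hzre
  have hpi : (Real.pi : ℂ) ≠ 0 := by exact_mod_cast Real.pi_ne_zero
  have hzn : 3 * |t| ≤ ‖z‖ := by
    have := Complex.abs_im_le_norm z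
    simpa [hz, abs_mul] using this
  rw [show (1 / 2 : ℂ) = ((1 / 2 : ℝ) : ℂ) by push_cast; rfl, Complex.norm_cpow_real,
    ← Real.sqrt_eq_rpow, norm_div, Complex.norm_real, Real.norm_of_nonneg Real.pi_pos.le]
  apply Real.sqrt_le_sqrt
  have := abs_pos.2 ht
  gcongr

/-- The dispersive estimate for frequencies in a strip. -/
lemma norm_integral_wave_strip_le {t : ℝ} (ht : t ≠ 0) (x : ℂ) :
    ‖∫ w : ℂ, wave t x w * strip w‖ ≤ 12 * Real.pi / |t| := by
  have hi : Integrable (fun z : ℝ × ℝ => wave t x ⟨z.1, z.2⟩ * strip ⟨z.1, z.2⟩)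
      (volume.prod volume) := by
    have h1 : Integrable (fun w : ℂ => wave t x w * strip w) := by
      refine integrable_strip.ofReal.bdd_mul (c := 1) ?_ ?_
      · exact (continuous_wave.comp (by fun_prop : Continuous fun w : ℂ => (t, x, w))).aestronglyMeasurable
      · exact Filter.Eventually.of_forall fun w => (norm_wave t x w).le
    exact (Complex.volume_preserving_equiv_real_prod.symm.integrable_comp_emb
      Complex.measurableEquivRealProd.symm.measurableEmbedding).2 h1
  have h2 : ∫ w : ℂ, wave t x w * strip w =
      ∫ z : ℝ × ℝ, wave t x ⟨z.1, z.2⟩ * strip ⟨z.1, z.2⟩ :=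
    (Complex.volume_preserving_equiv_real_prod.symm.integral_comp
      Complex.measurableEquivRealProd.symm.measurableEmbedding _).symm
  set d : ℝ := x.im ^ 2 / (4 * (1 + 9 * t ^ 2)) with hd
  set κ : ℂ := ((Real.pi : ℂ) / (1 - 3 * t * Complex.I)) ^ (1 / 2 : ℂ) with hκ
  have hinner : ∀ ξ : ℝ, ∫ η : ℝ, wave t x ⟨ξ, η⟩ * strip ⟨ξ, η⟩ =
      (Icc (1 / 2 : ℝ) 2).indicator (fun ξ => κ * ((Real.exp (-(d / ξ)) : ℂ) *
      Complex.exp ((x.re * ξ - t * ξ ^ 3 - 3 * t * d / ξ : ℝ) * Complex.I))) ξ := by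
    intro ξ
    by_cases hξ : ξ ∈ Icc (1 / 2 : ℝ) 2
    · have hpos : 0 < ξ := by linarith [hξ.1]
      have hg := integral_exp_gaussian t x.im hpos
      rw [indicator_of_mem hξ]
      have : ∀ η : ℝ, wave t x ⟨ξ, η⟩ * strip ⟨ξ, η⟩ =
          Complex.exp ((x.re * ξ - t * ξ ^ 3 : ℝ) * Complex.I) * ((√ξ : ℂ) *
          (Complex.exp ((x.im * η + 3 * t * ξ * η ^ 2 : ℝ) * Complex.I) *
            Real.exp (-(ξ * η ^ 2)))) := by
        intro η
        have h3 : wave t x ⟨ξ, η⟩ = Complex.exp ((x.re * ξ - t * ξ ^ 3 : ℝ) * Complex.I) *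
            Complex.exp ((x.im * η + 3 * t * ξ * η ^ 2 : ℝ) * Complex.I) := by
          rw [wave, ← Complex.exp_add]
          congr 1
          simp only [phase, phiNV]
          push_cast; ring
        rw [h3]
        simp only [strip, indicator_of_mem hξ]
        push_cast; ring
      simp_rw [this]
      rw [integral_const_mul, integral_const_mul, hg, mul_left_comm, ← hκ, ← hd]
      congr 1
      rw [mul_left_comm, ← Complex.exp_add]
      congr 2
      push_cast; ring
    · rw [indicator_of_notMem hξ]
      simp [strip, -one_div, indicator_of_notMem hξ]
  rw [h2, Measure.volume_eq_prod, integral_prod _ hi]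
  simp_rw [hinner]
  rw [integral_indicator measurableSet_Icc, integral_Icc_eq_integral_Ioc,
    ← intervalIntegral.integral_of_le (by norm_num), intervalIntegral.integral_const_mul, norm_mul]
  have ht' := abs_pos.2 ht
  refine (mul_le_mul (norm_cpow_half_le ht) (norm_integral_airy_le_abs ht (by positivity))
    (norm_nonneg _) (Real.sqrt_nonneg _)).trans ?_
  have h3t : 0 < 3 * |t| := by positivity
  rw [Real.sqrt_div Real.pi_pos.le, div_mul_div_comm, Real.mul_self_sqrt h3t.le,
    div_le_div_iff₀ h3t ht']
  have : √Real.pi ≤ Real.pi := by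
    rw [Real.sqrt_le_left Real.pi_pos.le]
    nlinarith [Real.pi_gt_three]
  nlinarith [Real.pi_pos]

lemma lintegral_comp_abs (G : ℝ → ℝ≥0∞) :
    ∫⁻ u : ℝ, G |u| = 2 * ∫⁻ u in Ioi (0 : ℝ), G u := by
  rw [← lintegral_add_compl (fun u => G |u|) (measurableSet_Ioi (a := (0 : ℝ))), two_mul]
  have h1 : ∫⁻ u in Ioi (0 : ℝ), G |u| = ∫⁻ u in Ioi (0 : ℝ), G u :=
    setLIntegral_congr_fun measurableSet_Ioi fun u hu => by
      simp only [abs_of_pos (mem_Ioi.1 hu)]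
  have h2 : ∫⁻ u in (Ioi (0 : ℝ))ᶜ, G |u| = ∫⁻ u in Ioi (0 : ℝ), G u := by
    rw [← h1, compl_Ioi, setLIntegral_congr Iio_ae_eq_Iic.symm,
      ← lintegral_indicator measurableSet_Iio, ← lintegral_indicator measurableSet_Ioi,
      ← lintegral_neg_eq_self]
    congr 1; ext u
    simp [indicator]
  rw [h1, h2]

lemma setLIntegral_rpow_Ioo {θ δ : ℝ} (hθ : θ < 1) (hδ : 0 < δ) :
    ∫⁻ u in Ioo 0 δ, ENNReal.ofReal (u ^ (-θ)) = ENNReal.ofReal (δ ^ (1 - θ) / (1 - θ)) := by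
  have hi : IntervalIntegrable (fun u : ℝ => u ^ (-θ)) volume 0 δ :=
    intervalIntegral.intervalIntegrable_rpow' (by linarith)
  rw [intervalIntegrable_iff_integrableOn_Ioo_of_le hδ.le] at hi
  rw [← ofReal_integral_eq_lintegral_ofReal hi]
  · rw [← integral_Ioc_eq_integral_Ioo, ← intervalIntegral.integral_of_le hδ.le,
      integral_rpow (Or.inl (by linarith)), Real.zero_rpow (by linarith), sub_zero]
    congr 2 <;> ring_nf
  · exact ae_restrict_of_forall_mem measurableSet_Ioo fun u hu => Real.rpow_nonneg hu.1.le _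

lemma setLIntegral_rpow_neg_two_Ioi {δ : ℝ} (hδ : 0 < δ) :
    ∫⁻ u in Ioi δ, ENNReal.ofReal (u ^ (-2 : ℝ)) = ENNReal.ofReal (1 / δ) := by
  rw [← ofReal_integral_eq_lintegral_ofReal (integrableOn_Ioi_rpow_of_lt (by norm_num) hδ)]
  · rw [integral_Ioi_rpow_of_lt (by norm_num) hδ]
    congr 1
    rw [show (-2 : ℝ) + 1 = -1 by norm_num, Real.rpow_neg_one]
    field_simp
  · exact ae_restrict_of_forall_mem measurableSet_Ioi fun u hu =>
      Real.rpow_nonneg (hδ.trans hu).le _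

lemma lintegral_mul_rpow_le {p r a N : ℝ} (hp : 2 < p) (hpr : p.HolderConjugate r)
    (ha : 0 < a) (hN : 0 < N) {g : ℝ → ℝ≥0∞} (hg : Measurable g)
    (hga : ∀ u, g u ≤ ENNReal.ofReal a) (hgN : ∫⁻ u, g u ^ r ≤ ENNReal.ofReal (N ^ r)) :
    ∫⁻ u, g u * ENNReal.ofReal (|u| ^ (-(2 / p))) ≤
      ENNReal.ofReal ((2 / (1 - 2 / p) + 2 ^ (1 / p)) * (N ^ (2 - r) * a ^ (r - 1))) := by
  have hr : 0 < r := hpr.symm.pos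
  have hp0 : 0 < p := hpr.pos
  have hθ : 2 / p < 1 := (div_lt_one hp0).2 hp
  have hr1 : r / p = r - 1 := hpr.symm.div_conj_eq_sub_one
  set δ : ℝ := (N / a) ^ r with hδ
  have hδ0 : 0 < δ := by positivity
  set k : ℝ → ℝ≥0∞ := fun u => ENNReal.ofReal (u ^ (-(2 / p))) with hk
  have hkm : Measurable k := by fun_prop
  have hsplit : ∀ u, g u * k |u| ≤ ENNReal.ofReal a * (Iio δ).indicator k |u| +
      (g * fun u => (Ici δ).indicator k |u|) u := by
    intro u
    by_cases hu : |u| < δ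
    · rw [indicator_of_mem (show |u| ∈ Iio δ from hu)]
      exact le_add_right (mul_le_mul_left (hga u) _)
    · rw [Pi.mul_apply, indicator_of_mem (show |u| ∈ Ici δ from not_lt.1 hu)]
      exact le_add_self
  refine (lintegral_mono hsplit).trans ?_
  rw [lintegral_add_left (by
    exact ((hkm.indicator measurableSet_Iio).comp measurable_norm).const_mul _)]
  have h1 : ∫⁻ u, ENNReal.ofReal a * (Iio δ).indicator k |u| =
      ENNReal.ofReal (a * (2 * (δ ^ (1 - 2 / p) / (1 - 2 / p)))) := by
    rw [lintegral_const_mul _ (by exact (hkm.indicator measurableSet_Iio).comp measurable_norm),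
      lintegral_comp_abs, lintegral_indicator measurableSet_Iio,
      Measure.restrict_restrict measurableSet_Iio, inter_comm, Ioi_inter_Iio,
      setLIntegral_rpow_Ioo hθ hδ0, ENNReal.ofReal_mul ha.le, ENNReal.ofReal_mul zero_le_two,
      ENNReal.ofReal_ofNat]
  have h2 : ∫⁻ u, (Ici δ).indicator k |u| ^ p = ENNReal.ofReal (2 * (1 / δ)) := by
    have : ∀ u : ℝ, (Ici δ).indicator k |u| ^ p =
        (Ici δ).indicator (fun u => ENNReal.ofReal (u ^ (-2 : ℝ))) |u| := by
      intro u
      by_cases hu : |u| ∈ Ici δ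
      · rw [indicator_of_mem hu, indicator_of_mem hu, hk,
          ENNReal.ofReal_rpow_of_nonneg (by positivity) hp0.le, ← Real.rpow_mul (abs_nonneg _)]
        congr 2
        field_simp
      · rw [indicator_of_notMem hu, indicator_of_notMem hu, ENNReal.zero_rpow_of_pos hp0]
    simp_rw [this]
    rw [lintegral_comp_abs, lintegral_indicator measurableSet_Ici,
      Measure.restrict_restrict measurableSet_Ici,
      inter_eq_left.2 (show Ici δ ⊆ Ioi (0 : ℝ) from fun u hu => hδ0.trans_le hu), setLIntegral_congr Ioi_ae_eq_Ici.symm,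
      setLIntegral_rpow_neg_two_Ioi hδ0, ENNReal.ofReal_mul zero_le_two,
      ENNReal.ofReal_ofNat]
  have h3 : ∫⁻ u, (g * fun u => (Ici δ).indicator k |u|) u ≤
      ENNReal.ofReal (N * (2 * (1 / δ)) ^ (1 / p)) := by
    refine (ENNReal.lintegral_mul_le_Lp_mul_Lq volume hpr.symm hg.aemeasurable
      (by exact ((hkm.indicator measurableSet_Ici).comp measurable_norm).aemeasurable)).trans ?_
    rw [h2, ENNReal.ofReal_mul hN.le, ENNReal.ofReal_rpow_of_nonneg (by positivity) (by positivity)]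
    gcongr
    refine (ENNReal.rpow_le_rpow hgN (by positivity)).trans (le_of_eq ?_)
    rw [ENNReal.ofReal_rpow_of_nonneg (by positivity) (by positivity), ← Real.rpow_mul hN.le,
      mul_one_div_cancel hr.ne', Real.rpow_one]
  rw [h1]
  refine (add_le_add_right h3 _).trans (le_of_eq ?_)
  have h1θ : 0 < 1 - 2 / p := by linarith
  rw [← ENNReal.ofReal_add (by positivity) (by positivity)]
  congr 1
  have e1 : a * δ ^ (1 - 2 / p) = N ^ (2 - r) * a ^ (r - 1) := by
    rw [hδ, ← Real.rpow_mul (by positivity), show r * (1 - 2 / p) = 2 - r by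
      rw [mul_sub, mul_one, mul_div_left_comm, hr1]; ring, Real.div_rpow hN.le ha.le,
      show a ^ (r - 1) = a / a ^ (2 - r) by
        rw [show r - 1 = 1 - (2 - r) by ring, Real.rpow_sub ha 1, Real.rpow_one]]
    ring
  have e2 : N * (1 / δ) ^ (1 / p) = N ^ (2 - r) * a ^ (r - 1) := by
    rw [hδ, one_div, ← Real.inv_rpow (by positivity), inv_div, ← Real.rpow_mul (by positivity),
      mul_one_div, hr1, Real.div_rpow ha.le hN.le, show N ^ (2 - r) = N / N ^ (r - 1) by
        rw [show 2 - r = 1 - (r - 1) by ring, Real.rpow_sub hN 1, Real.rpow_one]]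
    ring
  rw [Real.mul_rpow zero_le_two (by positivity)]
  linear_combination 2 / (1 - 2 / p) * e1 + 2 ^ (1 / p) * e2

/-- The Hardy-Littlewood-Sobolev inequality on the line, in quadratic form. -/
lemma lintegral_lintegral_mul_rpow_le {p r : ℝ} (hp : 2 < p) (hpr : p.HolderConjugate r)
    {f : ℝ → ℝ≥0∞} (hf : Measurable f) :
    ∫⁻ t, ∫⁻ s, f t * f s * ENNReal.ofReal (|t - s| ^ (-(2 / p))) ≤
      ENNReal.ofReal (2 * (2 / (1 - 2 / p) + 2 ^ (1 / p))) * (∫⁻ t, f t ^ r) ^ (2 / r) := by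
  have hr : 0 < r := hpr.symm.pos
  have hp0 : 0 < p := hpr.pos
  have hθ : 2 / p < 1 := (div_lt_one hp0).2 hp
  have h1θ : 0 < 1 - 2 / p := by linarith
  set C : ℝ := 2 / (1 - 2 / p) + 2 ^ (1 / p) with hC
  have hC0 : 0 < C := by positivity
  set m := ∫⁻ t, f t ^ r with hm
  rcases eq_or_ne m 0 with h0 | h0
  · have hf0 : f =ᵐ[volume] 0 := by
      have := (lintegral_eq_zero_iff (hf.pow_const r)).1 h0
      filter_upwards [this] with t ht
      simpa [ENNReal.rpow_eq_zero_iff, hr, hr.not_gt] using ht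
    have : ∫⁻ t, ∫⁻ s, f t * f s * ENNReal.ofReal (|t - s| ^ (-(2 / p))) = 0 := by
      rw [lintegral_eq_zero_of_ae_eq_zero]
      filter_upwards [hf0] with t ht
      simp [ht]
    rw [this]; exact zero_le
  rcases eq_or_ne m ∞ with htop | htop
  · rw [htop, ENNReal.top_rpow_of_pos (by positivity), ENNReal.mul_top (by simp; positivity)]
    exact le_top
  set N : ℝ := m.toReal ^ (1 / r) with hN
  have hm0 : 0 < m.toReal := ENNReal.toReal_pos h0 htop
  have hN0 : 0 < N := by positivity
  have hNr : N ^ r = m.toReal := by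
    rw [hN, ← Real.rpow_mul hm0.le, one_div_mul_cancel hr.ne', Real.rpow_one]
  set k : ℝ → ℝ≥0∞ := fun u => ENNReal.ofReal (|u| ^ (-(2 / p))) with hk
  have hkm : Measurable k := by fun_prop
  have hksymm : ∀ t s, k (t - s) = k (s - t) := fun t s => by simp only [hk, abs_sub_comm]
  set g : ℝ → ℝ → ℝ≥0∞ := fun t s => (if f s ≤ f t then f s else 0) with hg
  have hgm : Measurable (fun z : ℝ × ℝ => g z.1 z.2) :=
    Measurable.ite (measurableSet_le (by fun_prop) (by fun_prop)) (by fun_prop) measurable_const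
  have hmeas : Measurable (fun z : ℝ × ℝ => f z.1 * g z.1 z.2 * k (z.1 - z.2)) := by fun_prop
  have hpt : ∀ t s, f t * f s * k (t - s) ≤
      f t * g t s * k (t - s) + f s * g s t * k (s - t) := by
    intro t s
    rcases le_total (f s) (f t) with h | h
    · simp only [hg, if_pos h]; exact le_self_add
    · simp only [hg, if_pos h]; rw [hksymm t s, mul_comm (f t)]; exact le_add_self
  have hhalf : ∫⁻ t, ∫⁻ s, f t * g t s * k (t - s) ≤ ENNReal.ofReal C * m ^ (2 / r) := by
    have hin : ∀ᵐ t, ∫⁻ s, f t * g t s * k (t - s) ≤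
        ENNReal.ofReal (C * N ^ (2 - r)) * f t ^ r := by
      have hfin : ∀ᵐ t, f t ^ r < ∞ := ae_lt_top (hf.pow_const r) htop
      filter_upwards [hfin] with t ht
      have htt : f t ≠ ∞ := fun h => by simp [h, hr] at ht
      rcases eq_or_ne (f t) 0 with hz | hz
      · simp [hz]
      have ha : 0 < (f t).toReal := ENNReal.toReal_pos hz htt
      have := lintegral_mul_rpow_le (g := fun u => g t (t - u)) hp hpr ha hN0
        (by exact hgm.comp (by fun_prop : Measurable fun u : ℝ => (t, t - u)))
        (fun u => by
          rw [ENNReal.ofReal_toReal htt]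
          simp only [hg]; split_ifs with h
          · exact h
          · exact zero_le)
        (by
          rw [lintegral_sub_left_eq_self (fun s => g t s ^ r) t, hNr, ENNReal.ofReal_toReal htop]
          refine lintegral_mono fun s => ENNReal.rpow_le_rpow ?_ hr.le
          simp only [hg]; split_ifs
          · exact le_rfl
          · exact zero_le)
      have h2 : ∫⁻ s, f t * g t s * k (t - s) = f t * ∫⁻ u, g t (t - u) * k u := by
        rw [← lintegral_sub_left_eq_self _ t]
        simp_rw [sub_sub_cancel, mul_assoc]
        exact lintegral_const_mul _ ((hgm.comp (by fun_prop : Measurable fun u : ℝ => (t, t - u))).mul hkm)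
      rw [← hC] at this
      rw [h2]
      refine (mul_le_mul_right this _).trans (le_of_eq ?_)
      nth_rewrite 1 [← ENNReal.ofReal_toReal htt]
      nth_rewrite 3 [← ENNReal.ofReal_toReal htt]
      rw [ENNReal.ofReal_rpow_of_pos ha, ← ENNReal.ofReal_mul ha.le,
        ← ENNReal.ofReal_mul (by positivity)]
      congr 1
      rw [Real.rpow_sub ha, Real.rpow_one]
      field_simp
    refine (lintegral_mono_ae hin).trans (le_of_eq ?_)
    rw [lintegral_const_mul _ (hf.pow_const r), ← hm]
    nth_rewrite 1 [← ENNReal.ofReal_toReal htop]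
    nth_rewrite 2 [← ENNReal.ofReal_toReal htop]
    rw [ENNReal.ofReal_rpow_of_pos hm0, ← ENNReal.ofReal_mul (by positivity),
        ← ENNReal.ofReal_mul (by positivity)]
    congr 1
    rw [hN, ← Real.rpow_mul hm0.le, mul_assoc, ← Real.rpow_add_one hm0.ne']
    congr 2
    field_simp
    ring
  calc ∫⁻ t, ∫⁻ s, f t * f s * k (t - s)
      ≤ ∫⁻ t, ∫⁻ s, (f t * g t s * k (t - s) + f s * g s t * k (s - t)) :=
        lintegral_mono fun t => lintegral_mono fun s => hpt t s
    _ = (∫⁻ t, ∫⁻ s, f t * g t s * k (t - s)) + ∫⁻ t, ∫⁻ s, f s * g s t * k (s - t) := by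
        rw [← lintegral_add_left (by exact hmeas.lintegral_prod_right')]
        congr 1; ext t
        exact lintegral_add_left (hmeas.comp (by fun_prop : Measurable fun u : ℝ => (t, u))) _
    _ = (∫⁻ t, ∫⁻ s, f t * g t s * k (t - s)) + ∫⁻ t, ∫⁻ s, f t * g t s * k (t - s) := by
        congr 1
        exact lintegral_lintegral_swap (f := fun t s => f s * g s t * k (s - t))
          (hmeas.comp measurable_swap).aemeasurable
    _ ≤ ENNReal.ofReal (2 * C) * m ^ (2 / r) := by
        refine (add_le_add hhalf hhalf).trans (le_of_eq ?_)
        rw [ENNReal.ofReal_mul zero_le_two, ENNReal.ofReal_ofNat]; ring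

lemma setLIntegral_lt_le {α : Type*} [MeasurableSpace α] {μ : Measure α} {r l : ℝ} (hr : 1 ≤ r)
    (hl : 0 < l) {f : α → ℝ} (hf : Measurable f) :
    ∫⁻ y in {y | l < f y}, ENNReal.ofReal (f y) ∂μ ≤
      ENNReal.ofReal (l ^ (1 - r)) * ∫⁻ y, ENNReal.ofReal (f y ^ r) ∂μ := by
  rw [← lintegral_const_mul _ (by fun_prop)]
  refine (setLIntegral_mono (by fun_prop) fun y (hy : l < f y) => ?_).trans
    (setLIntegral_le_lintegral _ _)
  have hfy : 0 < f y := hl.trans hy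
  rw [← ENNReal.ofReal_mul (by positivity)]
  refine ENNReal.ofReal_le_ofReal ?_
  calc f y = f y ^ (1 - r) * f y ^ r := by
        rw [← Real.rpow_add hfy, sub_add_cancel, Real.rpow_one]
    _ ≤ l ^ (1 - r) * f y ^ r := by
        exact mul_le_mul_of_nonneg_right
          (Real.rpow_le_rpow_of_nonpos hl hy.le (by linarith)) (by positivity)

lemma measure_lt_le_of_split {α : Type*} [MeasurableSpace α] {μ : Measure α} {s : ℝ} (hs : 0 < s)
    {F : α → ℝ} {lo hi : α → ℝ≥0∞} (hlo : Measurable lo)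
    (h : ∀ x, ENNReal.ofReal (F x) ≤ lo x + hi x) (hhi : ∀ x, hi x ≤ ENNReal.ofReal (s / 2)) :
    μ {x | s < F x} ≤ ENNReal.ofReal (4 / s ^ 2) * ∫⁻ x, lo x ^ (2 : ℝ) ∂μ := by
  have hsub : {x | s < F x} ⊆ {x | ENNReal.ofReal (s / 2) ^ (2 : ℝ) ≤ lo x ^ (2 : ℝ)} := by
    intro x (hx : s < F x)
    refine ENNReal.rpow_le_rpow ?_ zero_le_two
    have h1 := (ENNReal.ofReal_le_ofReal hx.le).trans ((h x).trans (add_le_add_right (hhi x) _))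
    rw [show ENNReal.ofReal s = ENNReal.ofReal (s / 2) + ENNReal.ofReal (s / 2) by
      rw [← ENNReal.ofReal_add (by positivity) (by positivity), add_halves]] at h1
    exact (ENNReal.add_le_add_iff_right ENNReal.ofReal_ne_top).1 h1
  refine (measure_mono hsub).trans ?_
  have h2 := mul_meas_ge_le_lintegral (μ := μ) (hlo.pow_const (2 : ℝ))
    (ENNReal.ofReal (s / 2) ^ (2 : ℝ))
  calc _ = ENNReal.ofReal (4 / s ^ 2) * (ENNReal.ofReal (s / 2) ^ (2 : ℝ) *
        μ {x | ENNReal.ofReal (s / 2) ^ (2 : ℝ) ≤ lo x ^ (2 : ℝ)}) := by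
        rw [ENNReal.ofReal_rpow_of_pos (by positivity), ← mul_assoc,
          ← ENNReal.ofReal_mul (by positivity)]
        rw [show 4 / s ^ 2 * (s / 2) ^ (2 : ℝ) = 1 by
          rw [Real.rpow_two]; field_simp; norm_num]
        simp
    _ ≤ _ := mul_le_mul_right h2 _

/-- Marcinkiewicz interpolation between `L¹ → L^∞` and `L² → L²`. -/
lemma lintegral_rpow_le_of_split {α : Type*} [MeasurableSpace α] {μ : Measure α} [SFinite μ]
    {q r a b m : ℝ} (hq : 2 < q) (hqr : q.HolderConjugate r) (ha : 0 < a) (hb : 0 ≤ b)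
    (hm : 0 < m) {f F : α → ℝ} (hf : Measurable f) (hf0 : ∀ x, 0 ≤ f x)
    (hF : AEMeasurable F μ) (hF0 : ∀ x, 0 ≤ F x)
    (hsplit : ∀ l : ℝ, 0 < l → ∃ lo hi : α → ℝ≥0∞, Measurable lo ∧
      (∀ x, ENNReal.ofReal (F x) ≤ lo x + hi x) ∧
      (∀ x, hi x ≤ ENNReal.ofReal a * ∫⁻ y in {y | l < f y}, ENNReal.ofReal (f y) ∂μ) ∧
      ∫⁻ x, lo x ^ (2 : ℝ) ∂μ ≤
        ENNReal.ofReal b * ∫⁻ y in {y | f y ≤ l}, ENNReal.ofReal (f y ^ 2) ∂μ)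
    (hfm : ∫⁻ y, ENNReal.ofReal (f y ^ r) ∂μ ≤ ENNReal.ofReal m) :
    ∫⁻ x, ENNReal.ofReal (F x ^ q) ∂μ ≤
      ENNReal.ofReal (4 * q * b / (q - 2) * (2 * a * m) ^ (q - 2) * m) := by
  have hr : 1 < r := hqr.symm.lt
  have hq0 : 0 < q := by linarith
  set c := 2 * a * m with hc
  have hc0 : 0 < c := by positivity
  have hqr1 : (q - 1) * (r - 1) = 1 := by linarith [hqr.mul_eq_add, sub_mul q 1 (r - 1), mul_sub q r 1]
  set L : ℝ → ℝ := fun s => (c / s) ^ (q - 1) with hL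
  have hLm : Measurable L := by fun_prop
  have hmeas : ∀ s, 0 < s → μ {x | s < F x} ≤ ENNReal.ofReal (4 * b / s ^ 2) *
      ∫⁻ y in {y | f y ≤ L s}, ENNReal.ofReal (f y ^ 2) ∂μ := by
    intro s hs
    have hLs : 0 < L s := by positivity
    obtain ⟨lo, hi, hlo, h, hhi, h2⟩ := hsplit (L s) hLs
    refine (measure_lt_le_of_split hs hlo h fun x => (hhi x).trans ?_).trans ?_
    · refine (mul_le_mul_right ((setLIntegral_lt_le hr.le hLs hf).trans
        (mul_le_mul_right hfm _)) _).trans (le_of_eq ?_)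
      rw [← ENNReal.ofReal_mul (by positivity), ← ENNReal.ofReal_mul (by positivity)]
      congr 1
      have : L s ^ (1 - r) = s / c := by
        rw [hL]
        dsimp only
        rw [← Real.rpow_mul (by positivity), show (q - 1) * (1 - r) = -1 by linarith,
          Real.rpow_neg_one, inv_div]
      rw [this, hc]
      field_simp
    · refine (mul_le_mul_right h2 _).trans (le_of_eq ?_)
      rw [← mul_assoc, ← ENNReal.ofReal_mul (by positivity)]
      congr 2; ring
  rw [lintegral_rpow_eq_lintegral_meas_lt_mul μ (ae_of_all _ hF0) hF hq0]
  set E : Set (ℝ × α) := {z | f z.2 ≤ L z.1} with hE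
  have hEm : MeasurableSet E := measurableSet_le (by fun_prop) (by fun_prop)
  have hJm : Measurable (fun z : ℝ × α => E.indicator
      (fun z => ENNReal.ofReal (f z.2 ^ 2) * ENNReal.ofReal (z.1 ^ (-(3 - q)))) z) :=
    Measurable.indicator (by fun_prop) hEm
  have h1 : ∫⁻ s in Ioi (0 : ℝ), μ {x | s < F x} * ENNReal.ofReal (s ^ (q - 1)) ≤
      ENNReal.ofReal (4 * b) * ∫⁻ s in Ioi (0 : ℝ), ∫⁻ y, E.indicator (fun z =>
        ENNReal.ofReal (f z.2 ^ 2) * ENNReal.ofReal (z.1 ^ (-(3 - q)))) (s, y) ∂μ := by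
    rw [← lintegral_const_mul _ (by exact hJm.lintegral_prod_right')]
    refine setLIntegral_mono ((hJm.lintegral_prod_right').const_mul _) fun s (hs : 0 < s) => ?_
    refine (mul_le_mul_left (hmeas s hs) _).trans (le_of_eq ?_)
    have : ∀ y, E.indicator (fun z =>
        ENNReal.ofReal (f z.2 ^ 2) * ENNReal.ofReal (z.1 ^ (-(3 - q)))) (s, y) =
        {y | f y ≤ L s}.indicator (fun y => ENNReal.ofReal (f y ^ 2)) y *
          ENNReal.ofReal (s ^ (-(3 - q))) := by
      intro y
      by_cases hy : f y ≤ L s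
      · rw [indicator_of_mem (show (s, y) ∈ E from hy),
          indicator_of_mem (show y ∈ {y | f y ≤ L s} from hy)]
      · rw [indicator_of_notMem (show (s, y) ∉ E from hy),
          indicator_of_notMem (show y ∉ {y | f y ≤ L s} from hy), zero_mul]
    simp_rw [this]
    have hSm : MeasurableSet {y | f y ≤ L s} := measurableSet_le hf measurable_const
    rw [lintegral_mul_const _ (Measurable.indicator (by fun_prop) hSm),
      lintegral_indicator hSm]
    have e : s ^ (q - 1) = s ^ 2 * s ^ (-(3 - q)) := by
      rw [← Real.rpow_two, ← Real.rpow_add hs]; congr 1; ring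
    rw [e, ENNReal.ofReal_mul (by positivity),
      show 4 * b / s ^ 2 = 4 * b * (1 / s ^ 2) by ring, ENNReal.ofReal_mul (by positivity)]
    have : ENNReal.ofReal (1 / s ^ 2) * ENNReal.ofReal (s ^ 2) = 1 := by
      rw [← ENNReal.ofReal_mul (by positivity), one_div_mul_cancel (by positivity),
        ENNReal.ofReal_one]
    calc _ = ENNReal.ofReal (4 * b) * (ENNReal.ofReal (1 / s ^ 2) * ENNReal.ofReal (s ^ 2)) *
          ((∫⁻ y in {y | f y ≤ L s}, ENNReal.ofReal (f y ^ 2) ∂μ) *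
            ENNReal.ofReal (s ^ (-(3 - q)))) := by ring
      _ = _ := by rw [this, mul_one]
  have h2 : ∫⁻ s in Ioi (0 : ℝ), ∫⁻ y, E.indicator (fun z =>
        ENNReal.ofReal (f z.2 ^ 2) * ENNReal.ofReal (z.1 ^ (-(3 - q)))) (s, y) ∂μ ≤
      ENNReal.ofReal (c ^ (q - 2) / (q - 2)) * ∫⁻ y, ENNReal.ofReal (f y ^ r) ∂μ := by
    rw [lintegral_lintegral_swap hJm.aemeasurable, ← lintegral_const_mul _ (by fun_prop)]
    refine lintegral_mono fun y => ?_
    dsimp only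
    rcases (hf0 y).eq_or_lt with h0 | h0
    · have : ∀ s, E.indicator (fun z =>
        ENNReal.ofReal (f z.2 ^ 2) * ENNReal.ofReal (z.1 ^ (-(3 - q)))) (s, y) = 0 := by
        intro s
        by_cases hs : (s, y) ∈ E
        · rw [indicator_of_mem hs]; simp [← h0]
        · rw [indicator_of_notMem hs]
      rw [lintegral_congr this, lintegral_zero]
      exact zero_le
    set S := c * f y ^ (1 - r) with hS
    have hS0 : 0 < S := by positivity
    have hle : ∫⁻ s in Ioi (0 : ℝ), E.indicator (fun z =>
        ENNReal.ofReal (f z.2 ^ 2) * ENNReal.ofReal (z.1 ^ (-(3 - q)))) (s, y) ≤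
        ∫⁻ s in Ioc 0 S, ENNReal.ofReal (f y ^ 2) * ENNReal.ofReal (s ^ (-(3 - q))) := by
      rw [← lintegral_indicator measurableSet_Ioi, ← lintegral_indicator measurableSet_Ioc]
      refine lintegral_mono fun s => ?_
      by_cases hs : 0 < s
      · rw [indicator_of_mem (show s ∈ Ioi (0 : ℝ) from hs)]
        by_cases hsy : f y ≤ L s
        · have : s ∈ Ioc 0 S := by
            refine ⟨hs, ?_⟩
            have h3 : f y ^ (r - 1) ≤ c / s := by
              calc f y ^ (r - 1) ≤ L s ^ (r - 1) := by
                    exact Real.rpow_le_rpow h0.le hsy (by linarith)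
                _ = c / s := by
                    simp only [hL]
                    rw [← Real.rpow_mul (by positivity), hqr1, Real.rpow_one]
            rw [le_div_iff₀ hs] at h3
            rw [hS, show 1 - r = -(r - 1) by ring, Real.rpow_neg h0.le, ← div_eq_mul_inv,
              le_div_iff₀ (by positivity)]
            linarith
          rw [indicator_of_mem (show (s, y) ∈ E from hsy), indicator_of_mem this]
        · rw [indicator_of_notMem (show (s, y) ∉ E from hsy)]; exact zero_le
      · rw [indicator_of_notMem (show s ∉ Ioi (0 : ℝ) from hs)]; exact zero_le
    refine hle.trans (le_of_eq ?_)
    rw [lintegral_const_mul _ (by fun_prop), setLIntegral_congr Ioo_ae_eq_Ioc.symm,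
      setLIntegral_rpow_Ioo (by linarith) hS0, ← ENNReal.ofReal_mul (by positivity),
      ← ENNReal.ofReal_mul (by have : 0 < q - 2 := by linarith
                               positivity)]
    congr 1
    rw [show 1 - (3 - q) = q - 2 by ring, hS, Real.mul_rpow hc0.le (by positivity),
      ← Real.rpow_mul h0.le]
    have : f y ^ 2 * f y ^ ((1 - r) * (q - 2)) = f y ^ r := by
      rw [← Real.rpow_two, ← Real.rpow_add h0]; congr 1; linarith [hqr.mul_eq_add]
    rw [← this]; ring
  refine (mul_le_mul_right (h1.trans (mul_le_mul_right (h2.trans (mul_le_mul_right hfm _)) _)) _).trans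
    (le_of_eq ?_)
  have : 0 < q - 2 := by linarith
  rw [← ENNReal.ofReal_mul (by positivity), ← ENNReal.ofReal_mul (by positivity),
    ← ENNReal.ofReal_mul (by positivity)]
  congr 1; ring

open FourierTransform SchwartzMap in
lemma fourier_ae_eq {f : ℂ → ℂ} (h1 : Integrable f) (h2 : MemLp f 2) :
    (𝓕 f : ℂ → ℂ) =ᵐ[volume] (𝓕 (h2.toLp f) : Lp ℂ 2 (volume : Measure ℂ)) := by
  have hcont : Continuous (𝓕 f) := VectorFourier.fourierIntegral_continuous
    Real.continuous_fourierChar (by exact continuous_inner) h1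
  refine ae_eq_of_integral_contDiff_smul_eq hcont.locallyIntegrable
    ((Lp.memLp _).locallyIntegrable (by norm_num)) fun g hg hgs => ?_
  have hg' : HasCompactSupport (fun x => (g x : ℂ)) := hgs.comp_left (g := Complex.ofReal) rfl
  set G : 𝓢(ℂ, ℂ) := hg'.toSchwartzMap (Complex.ofRealCLM.contDiff.comp hg) with hG
  have e1 := DFunLike.congr_fun (Lp.fourier_toTemperedDistribution_eq (h2.toLp f)) G
  rw [TemperedDistribution.fourier_apply, Lp.toTemperedDistribution_apply,
    Lp.toTemperedDistribution_apply] at e1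
  have hG1 : ∀ x, G x = (g x : ℂ) := fun x => rfl
  have e2 : ∫ x, (𝓕 G : 𝓢(ℂ, ℂ)) x • (h2.toLp f) x = ∫ x, G x • (𝓕 f) x := by
    have := VectorFourier.integral_fourierIntegral_smul_eq_flip (L := innerₗ ℂ) (μ := volume)
      (ν := volume) Real.continuous_fourierChar (by exact continuous_inner) G.integrable h1
    rw [integral_congr_ae (g := fun x => (𝓕 G : 𝓢(ℂ, ℂ)) x • f x) (by
      filter_upwards [h2.coeFn_toLp] with x hx
      rw [hx])]
    simpa using! this
  simpa [hG1] using e2.symm.trans e1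

open FourierTransform in
lemma lintegral_fourier_eq {f : ℂ → ℂ} (h1 : Integrable f) (h2 : MemLp f 2) :
    ∫⁻ w, ‖𝓕 f w‖ₑ ^ (2 : ℝ) = ∫⁻ x, ‖f x‖ₑ ^ (2 : ℝ) := by
  have h := Lp.norm_fourier_eq (h2.toLp f)
  rw [Lp.norm_def, Lp.norm_def, ENNReal.toReal_eq_toReal_iff' (Lp.eLpNorm_ne_top _)
    (Lp.eLpNorm_ne_top _), ← eLpNorm_congr_ae (fourier_ae_eq h1 h2),
    eLpNorm_congr_ae h2.coeFn_toLp,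
    eLpNorm_eq_lintegral_rpow_enorm_toReal (by simp) (by simp),
    eLpNorm_eq_lintegral_rpow_enorm_toReal (by simp) (by simp)] at h
  exact ENNReal.rpow_left_injective (x := 1 / (2 : ℝ≥0∞).toReal) (by simp) (by simpa using h)

lemma map_mul_volume {c : ℂ} (hc : c ≠ 0) :
    Measure.map (fun w => c * w) volume = ENNReal.ofReal ((‖c‖ ^ 2)⁻¹) • (volume : Measure ℂ) := by
  have hdet : LinearMap.det (LinearMap.mul ℝ ℂ c) = ‖c‖ ^ 2 := by
    rw [← Complex.normSq_eq_norm_sq, ← Algebra.norm_complex_apply, Algebra.norm_apply]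
    rfl
  have := Measure.map_linearMap_addHaar_eq_smul_addHaar (volume : Measure ℂ)
    (f := LinearMap.mul ℝ ℂ c) (by rw [hdet]; positivity)
  rw [hdet, abs_of_nonneg (by positivity)] at this
  exact this

lemma measurableEmbedding_mul_left {c : ℂ} (hc : c ≠ 0) :
    MeasurableEmbedding fun w : ℂ => c * w :=
  (Homeomorph.mulLeft₀ c hc).measurableEmbedding

lemma lintegral_comp_mul_complex {c : ℂ} (hc : c ≠ 0) (f : ℂ → ℝ≥0∞) :
    ∫⁻ w, f w = ENNReal.ofReal (‖c‖ ^ 2) * ∫⁻ w, f (c * w) := by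
  rw [← (measurableEmbedding_mul_left hc).lintegral_map, map_mul_volume hc, lintegral_smul_measure,
    smul_eq_mul, ← mul_assoc, ← ENNReal.ofReal_mul (by positivity),
    mul_inv_cancel₀ (by positivity), ENNReal.ofReal_one, one_mul]

lemma integral_comp_mul_complex {c : ℂ} (hc : c ≠ 0) (f : ℂ → ℂ) :
    ∫ w, f w = (‖c‖ ^ 2 : ℝ) • ∫ w, f (c * w) := by
  rw [← (measurableEmbedding_mul_left hc).integral_map, map_mul_volume hc, integral_smul_measure,
    ENNReal.toReal_ofReal (by positivity), smul_smul, mul_inv_cancel₀ (by positivity), one_smul]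

lemma plancherel {f : ℂ → ℂ} (h1 : Integrable f) (h2 : MemLp f 2) :
    ∫⁻ w, ‖∫ x, wave 0 w x * f x‖ₑ ^ (2 : ℝ) =
      ENNReal.ofReal ((2 * Real.pi) ^ 2) * ∫⁻ x, ‖f x‖ₑ ^ (2 : ℝ) := by
  have hc : (-(2 * Real.pi) : ℂ) ≠ 0 := by
    simp [Real.pi_ne_zero]
  rw [lintegral_comp_mul_complex hc (fun w => ‖∫ x, wave 0 w x * f x‖ₑ ^ (2 : ℝ)),
    ← lintegral_fourier_eq h1 h2]
  congr 1
  · simp [abs_of_pos Real.pi_pos]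
  · refine lintegral_congr fun w => ?_
    rw [Real.fourier_eq' f w]
    refine congrArg (fun z : ℂ => ‖z‖ₑ ^ (2 : ℝ)) (integral_congr_ae (ae_of_all _ fun x => ?_))
    simp only [smul_eq_mul, wave, phase, phiNV, Complex.inner]
    congr 3
    simp
    ring

lemma phase_add (t s : ℝ) (x y w : ℂ) :
    phase (t + s) (x + y) w = phase t x w + phase s y w := by
  simp only [phase, Complex.add_re, Complex.add_im]; ring

lemma wave_add (t s : ℝ) (x y w : ℂ) : wave (t + s) (x + y) w = wave t x w * wave s y w := by
  rw [wave, wave, wave, phase_add, ← Complex.exp_add]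
  push_cast
  ring_nf

lemma wave_zero_neg_comm (w y : ℂ) : wave 0 (-w) y = wave 0 (-y) w := by
  simp only [wave, phase, Complex.neg_re, Complex.neg_im]
  congr 3
  ring

lemma conj_wave (t : ℝ) (x w : ℂ) :
    (starRingEnd ℂ) (wave t x w) = wave (-t) (-x) w := by
  rw [wave, wave, ← Complex.exp_conj]
  congr 1
  simp only [phase, map_mul, Complex.conj_ofReal, Complex.conj_I, Complex.neg_re, Complex.neg_im]
  push_cast
  ring

/-- The Fourier transform `∫ e^{-i x·w} f(x) dx` on `ℂ`. -/
noncomputable def ft (f : ℂ → ℂ) (w : ℂ) : ℂ := ∫ y, wave 0 (-w) y * f y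

/-- The frequency-localized evolution, with Fourier multiplier `e^{-itφ} ρ`. -/
noncomputable def evol (ρ : ℂ → ℝ) (t : ℝ) (f : ℂ → ℂ) (x : ℂ) : ℂ :=
  ∫ w, wave t x w * (ρ w * ft f w)

lemma norm_ft_le (f : ℂ → ℂ) (w : ℂ) : ‖ft f w‖ ≤ ∫ y, ‖f y‖ := by
  refine (norm_integral_le_integral_norm _).trans (le_of_eq ?_)
  simp [norm_wave]

lemma stronglyMeasurable_ft {f : ℂ → ℂ} (hf : Measurable f) : StronglyMeasurable (ft f) := by
  refine StronglyMeasurable.integral_prod_right (f := fun w y : ℂ => wave 0 (-w) y * f y) ?_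
  refine Measurable.stronglyMeasurable ?_
  have := (continuous_wave.comp (by fun_prop : Continuous fun z : ℂ × ℂ => ((0 : ℝ), -z.1, z.2)))
  exact this.measurable.mul (hf.comp measurable_snd)

lemma lintegral_ft {f : ℂ → ℂ} (h1 : Integrable f) (h2 : MemLp f 2) :
    ∫⁻ w, ‖ft f w‖ₑ ^ (2 : ℝ) =
      ENNReal.ofReal ((2 * Real.pi) ^ 2) * ∫⁻ x, ‖f x‖ₑ ^ (2 : ℝ) := by
  rw [← plancherel h1 h2]
  exact lintegral_neg_eq_self (fun w => ‖∫ x, wave 0 w x * f x‖ₑ ^ (2 : ℝ))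

section

variable {ρ : ℂ → ℝ} {M : ℝ}

lemma lintegral_rpow_two_lt_top {f : ℂ → ℂ} (h2 : MemLp f 2) :
    ∫⁻ x, ‖f x‖ₑ ^ (2 : ℝ) < ∞ := by
  have := lintegral_rpow_enorm_lt_top_of_eLpNorm_lt_top (by simp) (by simp) h2.2
  simpa using this

lemma lintegral_evol_le (hρm : Measurable ρ) (hρ0 : ∀ w, 0 ≤ ρ w) (hρM : ∀ w, ρ w ≤ M)
    (hρi : Integrable ρ) (t : ℝ) {f : ℂ → ℂ} (hf : Measurable f) (h1 : Integrable f)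
    (h2 : MemLp f 2) :
    ∫⁻ x, ‖evol ρ t f x‖ₑ ^ (2 : ℝ) ≤
      ENNReal.ofReal ((2 * Real.pi) ^ 4 * M ^ 2) * ∫⁻ x, ‖f x‖ₑ ^ (2 : ℝ) := by
  set g : ℂ → ℂ := fun w => wave t 0 w * (ρ w * ft f w) with hg
  have hM : 0 ≤ M := (hρ0 0).trans (hρM 0)
  have hw : Measurable (wave t 0) :=
    (continuous_wave.comp (by fun_prop : Continuous fun w : ℂ => (t, (0 : ℂ), w))).measurable
  have hgm : Measurable g :=
    hw.mul ((Complex.measurable_ofReal.comp hρm).mul (stronglyMeasurable_ft hf).measurable)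
  have hgn : ∀ w, ‖g w‖ = ρ w * ‖ft f w‖ := fun w => by
    simp [hg, norm_wave, abs_of_nonneg (hρ0 w)]
  have hg1 : Integrable g := by
    refine (hρi.mul_const (∫ y, ‖f y‖)).mono' hgm.aestronglyMeasurable (ae_of_all _ fun w => ?_)
    rw [hgn]
    exact mul_le_mul_of_nonneg_left (norm_ft_le f w) (hρ0 w)
  have hle : ∫⁻ w, ‖g w‖ₑ ^ (2 : ℝ) ≤
      ENNReal.ofReal ((2 * Real.pi) ^ 2 * M ^ 2) * ∫⁻ x, ‖f x‖ₑ ^ (2 : ℝ) := by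
    have : ∀ w, ‖g w‖ₑ ^ (2 : ℝ) ≤ ENNReal.ofReal (M ^ 2) * ‖ft f w‖ₑ ^ (2 : ℝ) := by
      intro w
      rw [← ofReal_norm, hgn, ENNReal.ofReal_mul (hρ0 w), ofReal_norm,
        ENNReal.mul_rpow_of_nonneg _ _ zero_le_two]
      gcongr
      rw [ENNReal.ofReal_rpow_of_nonneg (hρ0 w) zero_le_two, Real.rpow_two]
      exact ENNReal.ofReal_le_ofReal (pow_le_pow_left₀ (hρ0 w) (hρM w) 2)
    refine (lintegral_mono this).trans (le_of_eq ?_)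
    rw [lintegral_const_mul _ ((stronglyMeasurable_ft hf).measurable.enorm.pow_const _),
      lintegral_ft h1 h2, ← mul_assoc, ← ENNReal.ofReal_mul (by positivity)]
    congr 2; ring
  have hg2 : MemLp g 2 := by
    refine ⟨hgm.aestronglyMeasurable, ?_⟩
    rw [eLpNorm_lt_top_iff_lintegral_rpow_enorm_lt_top (by simp) (by simp)]
    simpa using! hle.trans_lt (ENNReal.mul_lt_top ENNReal.ofReal_lt_top
      (lintegral_rpow_two_lt_top h2))
  have he : ∀ x, evol ρ t f x = ∫ w, wave 0 x w * g w := fun x => by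
    refine integral_congr_ae (ae_of_all _ fun w => ?_)
    simp only [hg]
    rw [show wave t x w = wave 0 x w * wave t 0 w by rw [← wave_add, zero_add, add_zero],
      mul_assoc]
  simp_rw [he]
  rw [plancherel hg1 hg2]
  refine (mul_le_mul_right hle _).trans (le_of_eq ?_)
  rw [← mul_assoc, ← ENNReal.ofReal_mul (by positivity)]
  congr 2; ring

lemma measurable_wave_right (t : ℝ) (x : ℂ) : Measurable (wave t x) :=
  (continuous_wave.comp (by fun_prop : Continuous fun w : ℂ => (t, x, w))).measurable

lemma evol_eq_integral (hρi : Integrable ρ) (t : ℝ) {f : ℂ → ℂ}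
    (h1 : Integrable f) (x : ℂ) :
    evol ρ t f x = ∫ y, (∫ w, wave t (x - y) w * ρ w) * f y := by
  have hint : Integrable (fun z : ℂ × ℂ => wave t (x - z.2) z.1 * (ρ z.1 * f z.2)) := by
    refine (hρi.ofReal (𝕜 := ℂ)).mul_prod h1 |>.bdd_mul (c := 1) ?_ (ae_of_all _ fun z => (norm_wave ..).le)
    exact (continuous_wave.comp (by fun_prop : Continuous fun z : ℂ × ℂ =>
      (t, x - z.2, z.1))).aestronglyMeasurable
  calc evol ρ t f x = ∫ w, ∫ y, wave t (x - y) w * (ρ w * f y) := by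
        refine integral_congr_ae (ae_of_all _ fun w => ?_)
        simp only [ft]
        rw [← integral_const_mul, ← integral_const_mul]
        refine integral_congr_ae (ae_of_all _ fun y => ?_)
        simp only
        rw [wave_zero_neg_comm, sub_eq_add_neg, show wave t (x + -y) w = wave t x w * wave 0 (-y) w by
          rw [← wave_add, add_zero]]
        ring
    _ = ∫ y, ∫ w, wave t (x - y) w * (ρ w * f y) := integral_integral_swap hint
    _ = _ := by
        refine integral_congr_ae (ae_of_all _ fun y => ?_)
        simp only
        rw [← integral_mul_const]
        refine integral_congr_ae (ae_of_all _ fun w => ?_)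
        simp only; ring

lemma enorm_evol_le {A : ℝ} (hρi : Integrable ρ) {t : ℝ}
    (hA : ∀ x, ‖∫ w, wave t x w * ρ w‖ ≤ A) {f : ℂ → ℂ}
    (hf : Measurable f) (h1 : Integrable f) (x : ℂ) :
    ‖evol ρ t f x‖ₑ ≤ ENNReal.ofReal A * ∫⁻ y, ‖f y‖ₑ := by
  rw [evol_eq_integral hρi t h1, ← lintegral_const_mul _ hf.enorm]
  refine (enorm_integral_le_lintegral_enorm _).trans (lintegral_mono fun y => ?_)
  rw [enorm_mul, ← ofReal_norm]
  gcongr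
  exact hA _

lemma evol_add {f g : ℂ → ℂ} (hρm : Measurable ρ) (hρi : Integrable ρ) (t : ℝ)
    (hf : Measurable f) (h1 : Integrable f) (hg : Measurable g) (hg1 : Integrable g) (x : ℂ) :
    evol ρ t (f + g) x = evol ρ t f x + evol ρ t g x := by
  have key : ∀ {f : ℂ → ℂ}, Measurable f → Integrable f →
      Integrable fun w => wave t x w * (ρ w * ft f w) := by
    intro f hf hf1
    refine (hρi.norm.mul_const (∫ y, ‖f y‖)).mono' ?_ (ae_of_all _ fun w => ?_)
    · exact ((measurable_wave_right t x).mul ((Complex.measurable_ofReal.comp hρm).mul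
        (stronglyMeasurable_ft hf).measurable)).aestronglyMeasurable
    · simp only [norm_mul, norm_wave, one_mul, Complex.norm_real]
      exact mul_le_mul_of_nonneg_left (norm_ft_le f w) (norm_nonneg _)
  have hft : ∀ {f : ℂ → ℂ} (w : ℂ), Integrable f → Integrable fun y => wave 0 (-w) y * f y :=
    fun {f} w hf => hf.bdd_mul (c := 1) (measurable_wave_right 0 (-w)).aestronglyMeasurable
      (ae_of_all _ fun y => (norm_wave ..).le)
  rw [evol, evol, evol, ← integral_add (key hf h1) (key hg hg1)]
  refine integral_congr_ae (ae_of_all _ fun w => ?_)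
  have : ft (f + g) w = ft f w + ft g w := by
    rw [ft, ft, ft, ← integral_add (hft w h1) (hft w hg1)]
    refine integral_congr_ae (ae_of_all _ fun y => ?_)
    simp [mul_add]
  simp only [this]; ring

end

lemma measurable_evol {ρ : ℂ → ℝ} (hρm : Measurable ρ) (t : ℝ) {f : ℂ → ℂ} (hf : Measurable f) :
    Measurable (evol ρ t f) := by
  refine (StronglyMeasurable.integral_prod_right
    (f := fun x w : ℂ => wave t x w * (ρ w * ft f w)) (Measurable.stronglyMeasurable ?_)).measurable
  have := (continuous_wave.comp (by fun_prop : Continuous fun z : ℂ × ℂ => (t, z.1, z.2)))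
  exact this.measurable.mul ((Complex.measurable_ofReal.comp (hρm.comp measurable_snd)).mul
    ((stronglyMeasurable_ft hf).measurable.comp measurable_snd))

lemma lintegral_evol_rpow_le {ρ : ℂ → ℝ} {M A q r : ℝ} (hρm : Measurable ρ)
    (hρ0 : ∀ w, 0 ≤ ρ w) (hρM : ∀ w, ρ w ≤ M) (hM : 0 < M) (hρi : Integrable ρ) (hq : 2 < q)
    (hqr : q.HolderConjugate r) {t : ℝ} (hA0 : 0 < A) (hA : ∀ x, ‖∫ w, wave t x w * ρ w‖ ≤ A)
    {f : ℂ → ℂ} (hf : Measurable f) (h1 : Integrable f) (h2 : MemLp f 2) :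
    ∫⁻ x, ‖evol ρ t f x‖ₑ ^ q ≤
      ENNReal.ofReal (4 * q * ((2 * Real.pi) ^ 4 * M ^ 2) / (q - 2) * (2 * A) ^ (q - 2)) *
        (∫⁻ x, ‖f x‖ₑ ^ r) ^ (q - 1) := by
  have hq0 : 0 < q := by linarith
  have hq2 : 0 < q - 2 := by linarith
  have hq1 : 0 < q - 1 := by linarith
  have hr : 0 < r := hqr.symm.pos
  set m := ∫⁻ x, ‖f x‖ₑ ^ r with hm
  rcases eq_or_ne m 0 with h0 | h0
  · have hf0 : ∀ᵐ x, f x = 0 := by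
      filter_upwards [(lintegral_eq_zero_iff (hf.enorm.pow_const r)).1 h0] with x hx
      simpa [ENNReal.rpow_eq_zero_iff, hr, hr.not_gt] using hx
    have hft : ∀ w, ft f w = 0 := fun w => by
      rw [ft, integral_eq_zero_of_ae]
      filter_upwards [hf0] with y hy
      simp [hy]
    simp [evol, hft, hq0]
  rcases eq_or_ne m ∞ with htop | htop
  · rw [htop, ENNReal.top_rpow_of_pos hq1, ENNReal.mul_top (by simp; positivity)]
    exact le_top
  have hm0 : 0 < m.toReal := ENNReal.toReal_pos h0 htop
  have hsplit : ∀ l : ℝ, 0 < l → ∃ lo hi : ℂ → ℝ≥0∞, Measurable lo ∧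
      (∀ x, ENNReal.ofReal ‖evol ρ t f x‖ ≤ lo x + hi x) ∧
      (∀ x, hi x ≤ ENNReal.ofReal A * ∫⁻ y in {y | l < ‖f y‖}, ENNReal.ofReal ‖f y‖) ∧
      ∫⁻ x, lo x ^ (2 : ℝ) ≤ ENNReal.ofReal ((2 * Real.pi) ^ 4 * M ^ 2) *
        ∫⁻ y in {y | ‖f y‖ ≤ l}, ENNReal.ofReal (‖f y‖ ^ 2) := by
    intro l hl
    have hS : MeasurableSet {y | ‖f y‖ ≤ l} := measurableSet_le hf.norm measurable_const
    have hT : MeasurableSet {y | l < ‖f y‖} := measurableSet_lt measurable_const hf.norm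
    have hfS := hf.indicator hS
    have hfT := hf.indicator hT
    have hsum : {y | ‖f y‖ ≤ l}.indicator f + {y | l < ‖f y‖}.indicator f = f := by
      have := indicator_self_add_compl {y | ‖f y‖ ≤ l} f
      simpa only [compl_ofPred, not_le] using this
    refine ⟨fun x => ‖evol ρ t ({y | ‖f y‖ ≤ l}.indicator f) x‖ₑ,
      fun x => ‖evol ρ t ({y | l < ‖f y‖}.indicator f) x‖ₑ,
      (measurable_evol hρm t hfS).enorm, fun x => ?_, fun x => ?_, ?_⟩
    · rw [ofReal_norm]
      nth_rewrite 1 [← hsum]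
      rw [evol_add hρm hρi t hfS (h1.indicator hS) hfT (h1.indicator hT)]
      exact enorm_add_le _ _
    · refine (enorm_evol_le hρi hA hfT (h1.indicator hT) x).trans (le_of_eq ?_)
      rw [← lintegral_indicator hT]
      congr 2; ext y
      by_cases hy : y ∈ {y | l < ‖f y‖}
      · rw [indicator_of_mem hy, indicator_of_mem hy, ofReal_norm]
      · rw [indicator_of_notMem hy, indicator_of_notMem hy, enorm_zero]
    · refine (lintegral_evol_le hρm hρ0 hρM hρi t hfS (h1.indicator hS) (h2.indicator hS)).trans
        (le_of_eq ?_)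
      rw [← lintegral_indicator hS]
      congr 2; ext y
      by_cases hy : y ∈ {y | ‖f y‖ ≤ l}
      · rw [indicator_of_mem hy, indicator_of_mem hy, ← ofReal_norm,
          ENNReal.ofReal_rpow_of_nonneg (norm_nonneg _) zero_le_two, Real.rpow_two]
      · rw [indicator_of_notMem hy, indicator_of_notMem hy, enorm_zero,
          ENNReal.zero_rpow_of_pos zero_lt_two]
  have key := lintegral_rpow_le_of_split (μ := volume) hq hqr hA0
    (b := (2 * Real.pi) ^ 4 * M ^ 2) (by positivity) hm0
    hf.norm (fun x => norm_nonneg _) (measurable_evol hρm t hf).norm.aemeasurable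
    (fun x => norm_nonneg _) hsplit (by
      rw [ENNReal.ofReal_toReal htop, hm]
      refine le_of_eq (lintegral_congr fun y => ?_)
      rw [← ENNReal.ofReal_rpow_of_nonneg (norm_nonneg _) hr.le, ofReal_norm])
  have e1 : ∫⁻ x, ‖evol ρ t f x‖ₑ ^ q = ∫⁻ x, ENNReal.ofReal (‖evol ρ t f x‖ ^ q) :=
    lintegral_congr fun x => by
      rw [← ENNReal.ofReal_rpow_of_nonneg (norm_nonneg _) hq0.le, ofReal_norm]
  rw [e1]
  refine key.trans (le_of_eq ?_)
  rw [← ENNReal.ofReal_toReal htop, ENNReal.ofReal_rpow_of_pos (by simpa using hm0),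
    ← ENNReal.ofReal_mul (by positivity)]
  congr 1
  rw [ENNReal.ofReal_toReal htop, Real.mul_rpow (by positivity) hm0.le,
    show q - 1 = q - 2 + 1 by ring, Real.rpow_add_one hm0.ne']
  ring

/-- The constant in the dispersive estimate `lintegral_evol_rpow_rpow_le`. -/
noncomputable def dispConst (q M : ℝ) : ℝ :=
  (4 * q * ((2 * Real.pi) ^ 4 * M ^ 2) / (q - 2) * 2 ^ (q - 2)) ^ (1 / q)

lemma dispConst_pos {q M : ℝ} (hq : 2 < q) (hM : 0 < M) : 0 < dispConst q M := by
  have hq2 : 0 < q - 2 := by linarith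
  unfold dispConst
  positivity

/-- The dispersive estimate from `L^r` to its dual `L^q`. -/
lemma lintegral_evol_rpow_rpow_le {ρ : ℂ → ℝ} {M A p q r : ℝ} (hρm : Measurable ρ)
    (hρ0 : ∀ w, 0 ≤ ρ w) (hρM : ∀ w, ρ w ≤ M) (hM : 0 < M) (hρi : Integrable ρ) (hq : 2 < q)
    (hqr : q.HolderConjugate r) (hpq : 2 / p + 2 / q = 1) {t : ℝ} (hA0 : 0 < A)
    (hA : ∀ x, ‖∫ w, wave t x w * ρ w‖ ≤ A)
    {f : ℂ → ℂ} (hf : Measurable f) (h1 : Integrable f) (h2 : MemLp f 2) :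
    (∫⁻ x, ‖evol ρ t f x‖ₑ ^ q) ^ (1 / q) ≤
      ENNReal.ofReal (dispConst q M * A ^ (2 / p)) * (∫⁻ x, ‖f x‖ₑ ^ r) ^ (1 / r) := by
  have hq0 : 0 < q := by linarith
  have hq2 : 0 < q - 2 := by linarith
  refine (ENNReal.rpow_le_rpow (lintegral_evol_rpow_le hρm hρ0 hρM hM hρi hq hqr hA0 hA hf h1 h2)
    (by positivity)).trans (le_of_eq ?_)
  rw [ENNReal.mul_rpow_of_nonneg _ _ (by positivity), ENNReal.ofReal_rpow_of_nonneg
    (by positivity) (by positivity), ← ENNReal.rpow_mul]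
  congr 2
  · rw [Real.mul_rpow zero_le_two hA0.le, ← mul_assoc, Real.mul_rpow (by positivity)
      (by positivity), ← Real.rpow_mul hA0.le, dispConst]
    congr 2
    have : 2 / p = 1 - 2 / q := by linarith
    rw [this]; field_simp
  · have := hqr.one_div_add_one_div
    have h3 : 1 / r = 1 - 1 / q := by linarith
    rw [h3]; field_simp

lemma measurable_wave {α : Type*} [MeasurableSpace α] {a : α → ℝ} {b c : α → ℂ}
    (ha : Measurable a) (hb : Measurable b) (hc : Measurable c) :
    Measurable fun z => wave (a z) (b z) (c z) :=
  (continuous_wave.measurable.comp (ha.prodMk (hb.prodMk hc)) :)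

/-- The dual evolution operator `∫∫ e^{i(x·w - tφ(w))} Φ(t,x) dx dt`. -/
noncomputable def dualEvol (Φ : ℝ × ℂ → ℂ) (w : ℂ) : ℂ := ∫ z : ℝ × ℂ, wave z.1 z.2 w * Φ z

lemma integrable_wave_mul {Φ : ℝ × ℂ → ℂ} (hΦi : Integrable Φ) (w : ℂ) :
    Integrable fun z : ℝ × ℂ => wave z.1 z.2 w * Φ z :=
  hΦi.bdd_mul (c := 1) (continuous_wave.comp (by fun_prop : Continuous fun z : ℝ × ℂ =>
    (z.1, z.2, w))).aestronglyMeasurable (ae_of_all _ fun _ => (norm_wave ..).le)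

lemma norm_dualEvol_le (Φ : ℝ × ℂ → ℂ) (w : ℂ) : ‖dualEvol Φ w‖ ≤ ∫ z, ‖Φ z‖ := by
  refine (norm_integral_le_integral_norm _).trans (le_of_eq ?_)
  simp [norm_wave]

lemma stronglyMeasurable_dualEvol {Φ : ℝ × ℂ → ℂ} (hΦ : Measurable Φ) :
    StronglyMeasurable (dualEvol Φ) := by
  refine StronglyMeasurable.integral_prod_right
    (f := fun (w : ℂ) (z : ℝ × ℂ) => wave z.1 z.2 w * Φ z) (Measurable.stronglyMeasurable ?_)
  have := continuous_wave.comp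
    (by fun_prop : Continuous fun z : ℂ × (ℝ × ℂ) => (z.2.1, z.2.2, z.1))
  exact this.measurable.mul (hΦ.comp measurable_snd)

lemma conj_integral_wave_mul {Φ : ℝ × ℂ → ℂ} (s : ℝ) (w : ℂ) :
    (starRingEnd ℂ) (∫ y, wave s y w * Φ (s, y)) =
      wave (-s) 0 w * ft (fun y => (starRingEnd ℂ) (Φ (s, y))) w := by
  rw [← integral_conj, ft, ← integral_const_mul]
  refine integral_congr_ae (ae_of_all _ fun y => ?_)
  simp only [map_mul, conj_wave]
  rw [wave_zero_neg_comm, ← mul_assoc, ← wave_add, zero_add, add_zero]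

section

variable {ρ : ℂ → ℝ}

lemma stronglyMeasurable_evol_conj (hρm : Measurable ρ) {Φ : ℝ × ℂ → ℂ} (hΦ : Measurable Φ) :
    StronglyMeasurable fun z : (ℝ × ℂ) × ℝ =>
      evol ρ (z.1.1 - z.2) (fun y => (starRingEnd ℂ) (Φ (z.2, y))) z.1.2 := by
  have hconj : Measurable (starRingEnd ℂ : ℂ → ℂ) := Complex.continuous_conj.measurable
  have hft : Measurable fun z : ℝ × ℂ => ft (fun y => (starRingEnd ℂ) (Φ (z.1, y))) z.2 := by
    have h0 : Measurable fun z : (ℝ × ℂ) × ℂ => (z.1.1, z.2) :=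
      measurable_fst.fst.prodMk measurable_snd
    have h1 : Measurable fun z : (ℝ × ℂ) × ℂ => (starRingEnd ℂ) (Φ (z.1.1, z.2)) :=
      (hconj.comp (hΦ.comp h0) :)
    have h2 : Measurable fun z : (ℝ × ℂ) × ℂ => wave 0 (-z.1.2) z.2 :=
      measurable_wave measurable_const measurable_fst.snd.neg measurable_snd
    exact ((h2.mul h1).stronglyMeasurable.integral_prod_right' (ν := volume)).measurable
  have h1 : Measurable fun z : ((ℝ × ℂ) × ℝ) × ℂ => wave (z.1.1.1 - z.1.2) z.1.1.2 z.2 :=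
    measurable_wave (measurable_fst.fst.fst.sub measurable_fst.snd) measurable_fst.fst.snd
      measurable_snd
  have h2 : Measurable fun z : ((ℝ × ℂ) × ℝ) × ℂ => (ρ z.2 : ℂ) :=
    (Complex.measurable_ofReal.comp (hρm.comp measurable_snd) :)
  have h0 : Measurable fun z : ((ℝ × ℂ) × ℝ) × ℂ => (z.1.2, z.2) :=
    measurable_fst.snd.prodMk measurable_snd
  have h3 : Measurable fun z : ((ℝ × ℂ) × ℝ) × ℂ =>
      ft (fun y => (starRingEnd ℂ) (Φ (z.1.2, y))) z.2 := (hft.comp h0 :)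
  exact (h1.mul (h2.mul h3)).stronglyMeasurable.integral_prod_right' (ν := volume)

lemma lintegral_dualEvol_le_lintegral_evol (hρm : Measurable ρ) (hρ0 : ∀ w, 0 ≤ ρ w)
    (hρi : Integrable ρ) {Φ : ℝ × ℂ → ℂ} (hΦ : Measurable Φ) (hΦi : Integrable Φ) :
    ∫⁻ w, ‖dualEvol Φ w‖ₑ ^ (2 : ℝ) * ENNReal.ofReal (ρ w) ≤
      ∫⁻ t : ℝ, ∫⁻ s : ℝ, ∫⁻ x : ℂ, ‖Φ (t, x)‖ₑ *
        ‖evol ρ (t - s) (fun y => (starRingEnd ℂ) (Φ (s, y))) x‖ₑ := by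
  have hΦi' : Integrable Φ ((volume : Measure ℝ).prod (volume : Measure ℂ)) := hΦi
  set φ : ℝ → ℂ → ℂ := fun s w => ∫ y, wave s y w * Φ (s, y) with hφ
  have hφm : Measurable fun z : ℝ × ℂ => φ z.1 z.2 := by
    refine (StronglyMeasurable.integral_prod_right (f := fun (z : ℝ × ℂ) (y : ℂ) =>
      wave z.1 y z.2 * Φ (z.1, y)) (Measurable.stronglyMeasurable ?_)).measurable
    exact (measurable_wave measurable_fst.fst measurable_snd measurable_fst.snd).mul
      (hΦ.comp (measurable_fst.fst.prodMk measurable_snd))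
  have hφn : ∀ s w, ‖φ s w‖ ≤ ∫ y, ‖Φ (s, y)‖ := fun s w => by
    refine (norm_integral_le_integral_norm _).trans (le_of_eq ?_)
    simp [norm_wave]
  set J : ℂ × ((ℝ × ℂ) × ℝ) → ℂ := fun v =>
    (ρ v.1 * (wave v.2.1.1 v.2.1.2 v.1 * Φ v.2.1)) * (starRingEnd ℂ) (φ v.2.2 v.1) with hJ
  have hJi : Integrable J := by
    refine ((hρi.mul_prod (hΦi.norm.mul_prod hΦi'.integral_norm_prod_left))).mono' ?_
      (ae_of_all _ fun v => ?_)
    · have m1 : Measurable fun v : ℂ × ((ℝ × ℂ) × ℝ) => (ρ v.1 : ℂ) :=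
        (Complex.measurable_ofReal.comp (hρm.comp measurable_fst) :)
      have m2 : Measurable fun v : ℂ × ((ℝ × ℂ) × ℝ) => wave v.2.1.1 v.2.1.2 v.1 :=
        measurable_wave measurable_snd.fst.fst measurable_snd.fst.snd measurable_fst
      have m3 : Measurable fun v : ℂ × ((ℝ × ℂ) × ℝ) => Φ v.2.1 := (hΦ.comp measurable_snd.fst :)
      have m4 : Measurable fun v : ℂ × ((ℝ × ℂ) × ℝ) => (v.2.2, v.1) :=
        measurable_snd.snd.prodMk measurable_fst
      have m5 : Measurable fun v : ℂ × ((ℝ × ℂ) × ℝ) => (starRingEnd ℂ) (φ v.2.2 v.1) :=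
        (Complex.continuous_conj.measurable.comp (hφm.comp m4) :)
      exact (((m1.mul (m2.mul m3)).mul m5).aestronglyMeasurable :)
    · simp only [hJ, norm_mul, Complex.norm_real, Real.norm_of_nonneg (hρ0 _), norm_wave, one_mul,
        RCLike.norm_conj]
      rw [mul_assoc]
      gcongr
      · exact hρ0 _
      · exact hφn _ _
  have hHφ : ∀ w, ∫ s, φ s w = dualEvol Φ w := fun w =>
    (integral_prod _ (integrable_wave_mul hΦi w)).symm
  have h1 : ∀ w, ∫ v, J (w, v) = ((‖dualEvol Φ w‖ ^ 2 * ρ w : ℝ) : ℂ) := by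
    intro w
    have := integral_prod_mul (μ := (volume : Measure (ℝ × ℂ))) (ν := (volume : Measure ℝ))
      (fun z : ℝ × ℂ => (ρ w : ℂ) * (wave z.1 z.2 w * Φ z)) (fun s => (starRingEnd ℂ) (φ s w))
    refine this.trans ?_
    rw [integral_conj, hHφ, integral_const_mul]
    change _ * dualEvol Φ w * _ = _
    rw [mul_assoc, Complex.mul_conj, Complex.normSq_eq_norm_sq]
    push_cast; ring
  have h2 : ∀ v : (ℝ × ℂ) × ℝ, ∫ w, J (w, v) =
      Φ v.1 * evol ρ (v.1.1 - v.2) (fun y => (starRingEnd ℂ) (Φ (v.2, y))) v.1.2 := by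
    intro v
    rw [evol, ← integral_const_mul]
    refine integral_congr_ae (ae_of_all _ fun w => ?_)
    simp only [hJ, hφ]
    rw [conj_integral_wave_mul, show wave (v.1.1 - v.2) v.1.2 w = wave v.1.1 v.1.2 w * wave (-v.2) 0 w
      by rw [← wave_add, add_zero, sub_eq_add_neg]]
    ring
  have h3 : ∫ w, ((‖dualEvol Φ w‖ ^ 2 * ρ w : ℝ) : ℂ) =
      ∫ v : (ℝ × ℂ) × ℝ, Φ v.1 * evol ρ (v.1.1 - v.2)
        (fun y => (starRingEnd ℂ) (Φ (v.2, y))) v.1.2 := by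
    rw [← integral_congr_ae (ae_of_all _ h1), ← integral_congr_ae (ae_of_all _ h2)]
    exact integral_integral_swap hJi
  have h4 : ∫⁻ w, ‖dualEvol Φ w‖ₑ ^ (2 : ℝ) * ENNReal.ofReal (ρ w) =
      ‖∫ w, ((‖dualEvol Φ w‖ ^ 2 * ρ w : ℝ) : ℂ)‖ₑ := by
    rw [integral_complex_ofReal, ← ofReal_norm, Complex.norm_real, Real.norm_of_nonneg
      (integral_nonneg fun w => by have := hρ0 w; positivity),
      ofReal_integral_eq_lintegral_ofReal]
    · refine lintegral_congr fun w => ?_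
      rw [ENNReal.ofReal_mul (by positivity), ← ofReal_norm,
        ENNReal.ofReal_rpow_of_nonneg (norm_nonneg _) zero_le_two, Real.rpow_two]
    · refine (hρi.const_mul ((∫ z, ‖Φ z‖) ^ 2)).mono' ?_ (ae_of_all _ fun w => ?_)
      · exact (((stronglyMeasurable_dualEvol hΦ).measurable.norm.pow_const 2).mul
          hρm).aestronglyMeasurable
      · rw [Real.norm_of_nonneg (by have := hρ0 w; positivity)]
        exact mul_le_mul_of_nonneg_right
          (pow_le_pow_left₀ (norm_nonneg _) (norm_dualEvol_le Φ w) 2) (hρ0 w)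
    · exact ae_of_all _ fun w => by have := hρ0 w; positivity
  have hSm := stronglyMeasurable_evol_conj hρm hΦ
  have hSe : Measurable fun v : (ℝ × ℂ) × ℝ => ‖Φ v.1‖ₑ *
      ‖evol ρ (v.1.1 - v.2) (fun y => (starRingEnd ℂ) (Φ (v.2, y))) v.1.2‖ₑ :=
    (hΦ.comp measurable_fst).enorm.mul hSm.measurable.enorm
  rw [h4, h3]
  refine (enorm_integral_le_lintegral_enorm _).trans (le_of_eq ?_)
  simp_rw [enorm_mul]
  rw [Measure.volume_eq_prod, lintegral_prod _ hSe.aemeasurable, Measure.volume_eq_prod,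
    lintegral_prod _ hSe.lintegral_prod_right'.aemeasurable]
  refine lintegral_congr fun t => ?_
  exact lintegral_lintegral_swap (f := fun (x : ℂ) (s : ℝ) => ‖Φ (t, x)‖ₑ *
      ‖evol ρ (t - s) (fun y => (starRingEnd ℂ) (Φ (s, y))) x‖ₑ)
    (hSe.comp (by fun_prop : Measurable fun v : ℂ × ℝ => ((t, v.1), v.2))).aemeasurable

end

/-- The constant in the frequency-localized space-time estimate. -/
noncomputable def strichartzConst (p q M A : ℝ) : ℝ :=
  dispConst q M * A ^ (2 / p) * (2 * (2 / (1 - 2 / p) + 2 ^ (1 / p)))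

lemma lintegral_dualEvol_le {ρ : ℂ → ℝ} {p p' q r M A : ℝ} (hρm : Measurable ρ)
    (hρ0 : ∀ w, 0 ≤ ρ w) (hρM : ∀ w, ρ w ≤ M) (hM : 0 < M) (hρi : Integrable ρ) (hp : 2 < p)
    (hq : 2 < q) (hpp : p.HolderConjugate p') (hqr : q.HolderConjugate r) (hpq : 2 / p + 2 / q = 1)
    (hA0 : 0 < A) (hA : ∀ t : ℝ, t ≠ 0 → ∀ x, ‖∫ w, wave t x w * ρ w‖ ≤ A / |t|)
    {Φ : ℝ × ℂ → ℂ} (hΦ : Measurable Φ) (hΦi : Integrable Φ)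
    (hΦ1 : ∀ t, Integrable fun x => Φ (t, x)) (hΦ2 : ∀ t, MemLp (fun x => Φ (t, x)) 2) :
    ∫⁻ w, ‖dualEvol Φ w‖ₑ ^ (2 : ℝ) * ENNReal.ofReal (ρ w) ≤
      ENNReal.ofReal (strichartzConst p q M A) *
        (∫⁻ t, (∫⁻ x, ‖Φ (t, x)‖ₑ ^ r) ^ (p' / r)) ^ (2 / p') := by
  set f : ℝ → ℝ≥0∞ := fun t => (∫⁻ x, ‖Φ (t, x)‖ₑ ^ r) ^ (1 / r) with hf
  have hfm : Measurable f :=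
    (((hΦ.enorm.pow_const r).lintegral_prod_right' (ν := volume)).pow_const (1 / r) :)
  have hslice : ∀ t, Measurable fun x => Φ (t, x) := fun t => hΦ.comp measurable_prodMk_left
  have hconj : Measurable (starRingEnd ℂ : ℂ → ℂ) := Complex.continuous_conj.measurable
  have hcm : ∀ s, Measurable fun x => (starRingEnd ℂ) (Φ (s, x)) := fun s => hconj.comp (hslice s)
  have hd := dispConst_pos hq hM
  have key : ∀ t s : ℝ, s ≠ t → ∫⁻ x : ℂ, ‖Φ (t, x)‖ₑ *
        ‖evol ρ (t - s) (fun y => (starRingEnd ℂ) (Φ (s, y))) x‖ₑ ≤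
      ENNReal.ofReal (dispConst q M * A ^ (2 / p)) *
        (f t * f s * ENNReal.ofReal (|t - s| ^ (-(2 / p)))) := by
    intro t s hts
    have hts' : t - s ≠ 0 := sub_ne_zero.2 hts.symm
    have habs : 0 < |t - s| := abs_pos.2 hts'
    have h1 : Integrable fun y => (starRingEnd ℂ) (Φ (s, y)) :=
      (hΦ1 s).norm.mono' (hcm s).aestronglyMeasurable (ae_of_all _ fun x => by simp)
    have h2 : MemLp (fun y => (starRingEnd ℂ) (Φ (s, y))) 2 :=
      (hΦ2 s).of_le (hcm s).aestronglyMeasurable (ae_of_all _ fun x => by simp)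
    have hev := lintegral_evol_rpow_rpow_le hρm hρ0 hρM hM hρi hq hqr hpq (t := t - s)
      (div_pos hA0 habs) (hA _ hts') (hcm s) h1 h2
    refine (ENNReal.lintegral_mul_le_Lp_mul_Lq volume hqr.symm (hslice t).enorm.aemeasurable
      (measurable_evol hρm _ (hcm s)).enorm.aemeasurable).trans ?_
    refine (mul_le_mul_right hev _).trans (le_of_eq ?_)
    have e1 : ∫⁻ x, ‖(starRingEnd ℂ) (Φ (s, x))‖ₑ ^ r = ∫⁻ x, ‖Φ (s, x)‖ₑ ^ r := by
      refine lintegral_congr fun x => ?_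
      rw [← ofReal_norm, RCLike.norm_conj, ofReal_norm]
    have e2 : (A / |t - s|) ^ (2 / p) = A ^ (2 / p) * |t - s| ^ (-(2 / p)) := by
      rw [Real.div_rpow hA0.le habs.le, Real.rpow_neg habs.le]; rfl
    have e3 : ENNReal.ofReal (dispConst q M * (A / |t - s|) ^ (2 / p)) =
        ENNReal.ofReal (dispConst q M * A ^ (2 / p)) *
          ENNReal.ofReal (|t - s| ^ (-(2 / p))) := by
      rw [e2, ← mul_assoc, ENNReal.ofReal_mul (by positivity)]
    rw [e1, e3]
    simp only [hf]
    ring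
  calc _ ≤ _ := lintegral_dualEvol_le_lintegral_evol hρm hρ0 hρi hΦ hΦi
    _ ≤ ∫⁻ t, ∫⁻ s, ENNReal.ofReal (dispConst q M * A ^ (2 / p)) *
        (f t * f s * ENNReal.ofReal (|t - s| ^ (-(2 / p)))) := by
        refine lintegral_mono fun t => lintegral_mono_ae ?_
        filter_upwards [Measure.ae_ne volume t] with s hs using key t s hs
    _ = ENNReal.ofReal (dispConst q M * A ^ (2 / p)) *
        ∫⁻ t, ∫⁻ s, f t * f s * ENNReal.ofReal (|t - s| ^ (-(2 / p))) := by
        simp_rw [lintegral_const_mul' _ _ ENNReal.ofReal_ne_top]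
    _ ≤ _ := mul_le_mul_right (lintegral_lintegral_mul_rpow_le hp hpp hfm) _
    _ = _ := by
        have : ∀ t, f t ^ p' = (∫⁻ x, ‖Φ (t, x)‖ₑ ^ r) ^ (p' / r) := fun t => by
          rw [hf, ← ENNReal.rpow_mul]; congr 1; ring
        simp_rw [this]
        rw [← mul_assoc, ← ENNReal.ofReal_mul (by positivity), strichartzConst]

lemma rpow_ne_top_of_ne {a : ℝ≥0∞} (h0 : a ≠ 0) (h : a ≠ ∞) (y : ℝ) : a ^ y ≠ ∞ := by
  simp [ENNReal.rpow_eq_top_iff, h0, h]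

lemma exists_dual_function {p p' q r B N : ℝ} (hp : 2 < p) (hq : 2 < q)
    (hpp : p.HolderConjugate p') (hqr : q.HolderConjugate r) {U : ℝ × ℂ → ℂ} (hU : Measurable U)
    (hB : ∀ z, ‖U z‖ ≤ B) (hN : ∀ z, U z ≠ 0 → |z.1| ≤ N ∧ ‖z.2‖ ≤ N) :
    ∃ Φ : ℝ × ℂ → ℂ, Measurable Φ ∧ Integrable Φ ∧ (∀ t, Integrable fun x => Φ (t, x)) ∧
      (∀ t, MemLp (fun x => Φ (t, x)) 2) ∧ (∀ z, U z = 0 → Φ z = 0) ∧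
      (∀ z, U z * Φ z = ((‖U z * Φ z‖ : ℝ) : ℂ)) ∧
      ∫⁻ z, ‖U z * Φ z‖ₑ = ∫⁻ t, (∫⁻ x, ‖U (t, x)‖ₑ ^ q) ^ (p / q) ∧
      ∫⁻ t, (∫⁻ x, ‖Φ (t, x)‖ₑ ^ r) ^ (p' / r) = ∫⁻ t, (∫⁻ x, ‖U (t, x)‖ₑ ^ q) ^ (p / q) ∧
      ∫⁻ t, (∫⁻ x, ‖U (t, x)‖ₑ ^ q) ^ (p / q) < ∞ := by
  have hB0 : 0 ≤ B := (norm_nonneg _).trans (hB 0)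
  have hr := hqr.symm.pos
  have hp'0 := hpp.symm.pos
  have hslice : ∀ t, Measurable fun x => U (t, x) := fun t => hU.comp measurable_prodMk_left
  set S : Set ℂ := Metric.closedBall 0 N with hS
  have hSv : volume S < ∞ := measure_closedBall_lt_top
  set m : ℝ → ℝ≥0∞ := fun t => ∫⁻ x, ‖U (t, x)‖ₑ ^ q with hm
  have hmm : Measurable m := (((hU.enorm.pow_const q).lintegral_prod_right' (ν := volume)) :)
  set K : ℝ≥0∞ := ENNReal.ofReal B ^ q * volume S with hK
  have hKtop : K < ∞ :=
    ENNReal.mul_lt_top (ENNReal.rpow_lt_top_of_nonneg (by linarith) ENNReal.ofReal_ne_top) hSv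
  have hUe : ∀ z, ‖U z‖ₑ ≤ ENNReal.ofReal B := fun z => by
    rw [← ofReal_norm]; exact ENNReal.ofReal_le_ofReal (hB z)
  have hmK : ∀ t, m t ≤ K := by
    intro t
    rw [hm, hK, ← setLIntegral_const, ← lintegral_indicator measurableSet_closedBall]
    refine lintegral_mono fun x => ?_
    by_cases hx : U (t, x) = 0
    · simp [hx, show 0 < q by linarith]
    · rw [indicator_of_mem (by simpa [hS] using (hN _ hx).2)]
      exact ENNReal.rpow_le_rpow (hUe _) (by linarith)
  have hm0 : ∀ t, t ∉ Icc (-N) N → m t = 0 := by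
    intro t ht
    have : ∀ x, U (t, x) = 0 := fun x => by
      by_contra h
      exact ht (abs_le.1 (hN _ h).1)
    simp [hm, this, show 0 < q by linarith]
  have hpow : ∀ a : ℝ, 0 < a → ∫⁻ t, m t ^ a < ∞ := by
    intro a ha
    calc ∫⁻ t, m t ^ a ≤ ∫⁻ t, (Icc (-N) N).indicator (fun _ => K ^ a) t := by
          refine lintegral_mono fun t => ?_
          by_cases ht : t ∈ Icc (-N) N
          · rw [indicator_of_mem ht]
            exact ENNReal.rpow_le_rpow (hmK t) ha.le
          · simp [hm0 t ht, ha]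
      _ < ∞ := by
          rw [lintegral_indicator measurableSet_Icc, setLIntegral_const]
          exact ENNReal.mul_lt_top (ENNReal.rpow_lt_top_of_nonneg ha.le hKtop.ne)
            measure_Icc_lt_top
  set κ : ℝ → ℝ := fun t => (m t ^ ((p - q) / q)).toReal with hκ
  have hκm : Measurable κ := (hmm.pow_const _).ennreal_toReal
  have hκ0 : ∀ t, 0 ≤ κ t := fun t => ENNReal.toReal_nonneg
  have hκe : ∀ t, m t ≠ 0 → ENNReal.ofReal (κ t) = m t ^ ((p - q) / q) := fun t ht =>
    ENNReal.ofReal_toReal (rpow_ne_top_of_ne ht ((hmK t).trans_lt hKtop).ne _)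
  set Φ : ℝ × ℂ → ℂ := fun z => (starRingEnd ℂ) (U z) * ((‖U z‖ ^ (q - 2) * κ z.1 : ℝ) : ℂ) with hΦ
  have hΦm : Measurable Φ :=
    ((Complex.continuous_conj.measurable.comp hU :).mul (Complex.measurable_ofReal.comp
      ((hU.norm.pow_const (q - 2)).mul (hκm.comp measurable_fst) :) :) :)
  have hΦs : ∀ t, Measurable fun x => Φ (t, x) := fun t => hΦm.comp measurable_prodMk_left
  have hΦn : ∀ z, ‖Φ z‖ = ‖U z‖ ^ (q - 1) * κ z.1 := by
    intro z
    have : ‖U z‖ ^ (q - 1) = ‖U z‖ * ‖U z‖ ^ (q - 2) := by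
      rw [← Real.rpow_one_add' (norm_nonneg _) (by linarith)]; congr 1; ring
    rw [hΦ]
    simp only
    rw [norm_mul, RCLike.norm_conj, Complex.norm_real, Real.norm_of_nonneg
      (mul_nonneg (by positivity) (hκ0 _)), this, mul_assoc]
  have hΦe : ∀ z, ‖Φ z‖ₑ = ‖U z‖ₑ ^ (q - 1) * ENNReal.ofReal (κ z.1) := by
    intro z
    rw [← ofReal_norm, hΦn, ENNReal.ofReal_mul (by positivity), ← ofReal_norm,
      ENNReal.ofReal_rpow_of_nonneg (norm_nonneg _) (by linarith)]
  have hΦ0 : ∀ z, U z = 0 → Φ z = 0 := fun z hz => by simp [hΦ, hz]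
  have hUa : ∀ t, m t = 0 → ∀ᵐ x, U (t, x) = 0 := by
    intro t ht
    have := (lintegral_eq_zero_iff ((hslice t).enorm.pow_const q)).1 ht
    filter_upwards [this] with x hx
    simpa [show 0 < q by linarith, show ¬ q < 0 by linarith] using hx
  -- the slice norms of `Φ`
  have hΦr : ∀ t, ∫⁻ x, ‖Φ (t, x)‖ₑ ^ r = m t ^ ((p - 1) / q * r) := by
    intro t
    rcases eq_or_ne (m t) 0 with h0 | h0
    · rw [h0, ENNReal.zero_rpow_of_pos (by have : 0 < p - 1 := by linarith
                                           positivity)]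
      refine (lintegral_congr_ae ?_).trans lintegral_zero
      filter_upwards [hUa t h0] with x hx
      rw [hΦ0 _ hx]; simp [hr]
    · simp_rw [hΦe, hκe t h0, ENNReal.mul_rpow_of_nonneg _ _ hr.le]
      rw [lintegral_mul_const' _ _ (ENNReal.rpow_ne_top_of_nonneg hr.le
        (rpow_ne_top_of_ne h0 ((hmK t).trans_lt hKtop).ne _))]
      simp_rw [← ENNReal.rpow_mul]
      have e : (q - 1) * r = q := by
        have := hqr.sub_one_mul_conj; linarith
      rw [e]
      change m t * _ = _
      nth_rewrite 1 [← ENNReal.rpow_one (m t)]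
      rw [← ENNReal.rpow_add _ _ h0 ((hmK t).trans_lt hKtop).ne]
      congr 1
      have : q ≠ 0 := by linarith
      field_simp
      linarith
  have hΦ1 : ∀ t, ∫⁻ x, ‖Φ (t, x)‖ₑ ≤ m t ^ ((p - 1) / q) * volume S ^ (1 / q) := by
    intro t
    have h1 : ∫⁻ x, ‖Φ (t, x)‖ₑ = ∫⁻ x, ‖Φ (t, x)‖ₑ * S.indicator 1 x := by
      refine lintegral_congr fun x => ?_
      by_cases hx : U (t, x) = 0
      · simp [hΦ0 _ hx]
      · rw [indicator_of_mem (by simpa [hS] using (hN _ hx).2)]; simp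
    rw [h1]
    refine (ENNReal.lintegral_mul_le_Lp_mul_Lq volume hqr.symm (hΦs t).enorm.aemeasurable
      (measurable_one.indicator measurableSet_closedBall).aemeasurable).trans (le_of_eq ?_)
    rw [hΦr, ← ENNReal.rpow_mul]
    congr 1
    · congr 1; field_simp
    · congr 1
      rw [← lintegral_indicator_one measurableSet_closedBall]
      refine lintegral_congr fun x => ?_
      by_cases hx : x ∈ S
      · rw [indicator_of_mem hx]; simp
      · rw [indicator_of_notMem hx]; simp [show 0 < q by linarith]
  have hp1 : 0 < (p - 1) / q := div_pos (by linarith) (by linarith)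
  have hΦi : Integrable Φ := by
    refine ⟨hΦm.aestronglyMeasurable, ?_⟩
    rw [HasFiniteIntegral, Measure.volume_eq_prod, lintegral_prod _ hΦm.enorm.aemeasurable]
    refine (lintegral_mono hΦ1).trans_lt ?_
    rw [lintegral_mul_const' _ _ (ENNReal.rpow_ne_top_of_nonneg (by positivity) hSv.ne)]
    exact ENNReal.mul_lt_top (hpow _ hp1) (ENNReal.rpow_lt_top_of_nonneg (by positivity) hSv.ne)
  have hΦ1i : ∀ t, Integrable fun x => Φ (t, x) := fun t =>
    ⟨(hΦs t).aestronglyMeasurable, (hΦ1 t).trans_lt (ENNReal.mul_lt_top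
      (ENNReal.rpow_lt_top_of_nonneg hp1.le ((hmK t).trans_lt hKtop).ne)
      (ENNReal.rpow_lt_top_of_nonneg (by positivity) hSv.ne))⟩
  have hΦ2 : ∀ t, MemLp (fun x => Φ (t, x)) 2 := fun t => by
    have e : (fun x => Φ (t, x)) = S.indicator fun x => Φ (t, x) := by
      ext x
      by_cases hx : U (t, x) = 0
      · by_cases h : x ∈ S <;> simp [indicator, h, hΦ0 _ hx]
      · rw [indicator_of_mem (by simpa [hS] using (hN _ hx).2)]
    rw [e, memLp_indicator_iff_restrict measurableSet_closedBall]
    have : IsFiniteMeasure (volume.restrict S) := ⟨by simpa using hSv⟩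
    refine MemLp.of_bound (hΦs t).aestronglyMeasurable (B ^ (q - 1) * κ t)
      (ae_of_all _ fun x => ?_)
    rw [hΦn]
    exact mul_le_mul_of_nonneg_right (Real.rpow_le_rpow (norm_nonneg _) (hB _) (by linarith))
      (hκ0 t)
  have hUΦ : ∀ z, U z * Φ z = ((‖U z * Φ z‖ : ℝ) : ℂ) := by
    intro z
    have : U z * Φ z = ((‖U z‖ ^ 2 * (‖U z‖ ^ (q - 2) * κ z.1) : ℝ) : ℂ) := by
      rw [hΦ]
      simp only
      rw [← mul_assoc, Complex.mul_conj, Complex.normSq_eq_norm_sq, ← Complex.ofReal_mul]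
    rw [this, Complex.norm_real, Real.norm_of_nonneg]
    have := hκ0 z.1
    positivity
  refine ⟨Φ, hΦm, hΦi, hΦ1i, hΦ2, hΦ0, hUΦ, ?_, ?_, hpow _ (by positivity)⟩
  · rw [Measure.volume_eq_prod, lintegral_prod (fun z => ‖U z * Φ z‖ₑ) (hU.mul hΦm).enorm.aemeasurable]
    refine lintegral_congr fun t => ?_
    change _ = m t ^ (p / q)
    rcases eq_or_ne (m t) 0 with h0 | h0
    · rw [h0, ENNReal.zero_rpow_of_pos (by positivity)]
      refine (lintegral_congr_ae ?_).trans lintegral_zero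
      filter_upwards [hUa t h0] with x hx
      rw [hx]; simp
    · simp_rw [enorm_mul, hΦe, hκe t h0, ← mul_assoc]
      rw [lintegral_mul_const' _ _ (rpow_ne_top_of_ne h0 ((hmK t).trans_lt hKtop).ne _)]
      have e : ∀ x, ‖U (t, x)‖ₑ * ‖U (t, x)‖ₑ ^ (q - 1) = ‖U (t, x)‖ₑ ^ q := fun x => by
        nth_rewrite 1 [← ENNReal.rpow_one ‖U (t, x)‖ₑ]
        rw [← ENNReal.rpow_add_of_nonneg _ _ zero_le_one (by linarith)]
        congr 1; ring
      simp_rw [e]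
      change m t * _ = _
      nth_rewrite 1 [← ENNReal.rpow_one (m t)]
      rw [← ENNReal.rpow_add _ _ h0 ((hmK t).trans_lt hKtop).ne]
      congr 1
      have : q ≠ 0 := by linarith
      field_simp
      linarith
  · refine lintegral_congr fun t => ?_
    rw [hΦr, ← ENNReal.rpow_mul]
    change m t ^ _ = m t ^ _
    congr 1
    have : (p - 1) * p' = p := hpp.sub_one_mul_conj
    have : q ≠ 0 := by linarith
    field_simp
    linarith

/-- The space-time function with frequency profile `H`. -/
noncomputable def extension (H : ℂ → ℂ) (z : ℝ × ℂ) : ℂ := ∫ w, wave z.1 z.2 w * H w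

lemma measurable_extension {H : ℂ → ℂ} (hH : Measurable H) : Measurable (extension H) := by
  have h1 : Measurable fun z : (ℝ × ℂ) × ℂ => wave z.1.1 z.1.2 z.2 :=
    measurable_wave measurable_fst.fst measurable_fst.snd measurable_snd
  have h2 : Measurable fun z : (ℝ × ℂ) × ℂ => H z.2 := (hH.comp measurable_snd :)
  exact ((h1.mul h2).stronglyMeasurable.integral_prod_right' (ν := volume)).measurable

lemma norm_extension_le (H : ℂ → ℂ) (z : ℝ × ℂ) : ‖extension H z‖ ≤ ∫ w, ‖H w‖ := by
  refine (norm_integral_le_integral_norm _).trans (le_of_eq ?_)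
  simp [norm_wave]

lemma integral_extension_mul {H : ℂ → ℂ} (hH : Integrable H)
    {Φ : ℝ × ℂ → ℂ} (hΦi : Integrable Φ) :
    ∫ z, extension H z * Φ z = ∫ w, H w * dualEvol Φ w := by
  have hint : Integrable (fun v : (ℝ × ℂ) × ℂ => wave v.1.1 v.1.2 v.2 * (Φ v.1 * H v.2)) := by
    refine (hΦi.mul_prod hH).bdd_mul (c := 1) ?_ (ae_of_all _ fun z => (norm_wave ..).le)
    have h1 : Measurable fun z : (ℝ × ℂ) × ℂ => wave z.1.1 z.1.2 z.2 :=
      measurable_wave measurable_fst.fst measurable_fst.snd measurable_snd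
    exact h1.aestronglyMeasurable
  calc ∫ z, extension H z * Φ z = ∫ z : ℝ × ℂ, ∫ w, wave z.1 z.2 w * (Φ z * H w) := by
        refine integral_congr_ae (ae_of_all _ fun z => ?_)
        simp only [extension]
        rw [← integral_mul_const]
        refine integral_congr_ae (ae_of_all _ fun w => ?_)
        simp only; ring
    _ = ∫ w, ∫ z : ℝ × ℂ, wave z.1 z.2 w * (Φ z * H w) := integral_integral_swap hint
    _ = _ := by
        refine integral_congr_ae (ae_of_all _ fun w => ?_)
        simp only [dualEvol]
        rw [← integral_const_mul]
        refine integral_congr_ae (ae_of_all _ fun z => ?_)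
        simp only; ring

lemma rpow_one_div_le_of_le_mul_rpow {p p' : ℝ} (hpp : p.HolderConjugate p') {a d : ℝ≥0∞}
    (ha : a < ∞) (h : a ≤ d * a ^ (1 / p')) : a ^ (1 / p) ≤ d := by
  have hp := hpp.pos
  rcases eq_or_ne a 0 with h0 | h0
  · rw [h0, ENNReal.zero_rpow_of_pos (by positivity)]; exact zero_le
  · have hne : a ^ (1 / p') ≠ ∞ := rpow_ne_top_of_ne h0 ha.ne _
    have hn0 : a ^ (1 / p') ≠ 0 := by
      simp [ENNReal.rpow_eq_zero_iff, h0, ha.ne]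
    refine (ENNReal.mul_le_mul_iff_left hn0 hne).1 (le_trans (le_of_eq ?_) h)
    rw [← ENNReal.rpow_add _ _ h0 ha.ne]
    have := hpp.inv_add_inv_eq_one
    simp only [one_div, this, ENNReal.rpow_one]

section

variable {ρ : ℂ → ℝ}

lemma lintegral_mul_dualEvol_le (hρm : Measurable ρ) (hρ0 : ∀ w, 0 ≤ ρ w) {h : ℂ → ℂ}
    (hh : Measurable h) {Φ : ℝ × ℂ → ℂ} (hΦ : Measurable Φ) :
    ∫⁻ w, ‖(ρ w : ℂ) * h w * dualEvol Φ w‖ₑ ≤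
      (∫⁻ w, ‖h w‖ₑ ^ (2 : ℝ) * ENNReal.ofReal (ρ w)) ^ (1 / (2 : ℝ)) *
        (∫⁻ w, ‖dualEvol Φ w‖ₑ ^ (2 : ℝ) * ENNReal.ofReal (ρ w)) ^ (1 / (2 : ℝ)) := by
  have hs : Measurable fun w => ENNReal.ofReal (ρ w) ^ (1 / (2 : ℝ)) :=
    hρm.ennreal_ofReal.pow_const _
  have hd := (stronglyMeasurable_dualEvol hΦ).measurable.enorm
  have e : ∀ w, ‖(ρ w : ℂ) * h w * dualEvol Φ w‖ₑ =
      (‖h w‖ₑ * ENNReal.ofReal (ρ w) ^ (1 / (2 : ℝ))) *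
        (‖dualEvol Φ w‖ₑ * ENNReal.ofReal (ρ w) ^ (1 / (2 : ℝ))) := by
    intro w
    have h1 : ‖(ρ w : ℂ)‖ₑ = ENNReal.ofReal (ρ w) ^ (1 / (2 : ℝ)) *
        ENNReal.ofReal (ρ w) ^ (1 / (2 : ℝ)) := by
      rw [← ENNReal.rpow_add_of_nonneg _ _ (by norm_num) (by norm_num), ← ofReal_norm,
        Complex.norm_real, Real.norm_of_nonneg (hρ0 w)]
      norm_num
    rw [enorm_mul, enorm_mul, h1]; ring
  have e2 : ∀ a b : ℝ≥0∞, (a * b ^ (1 / (2 : ℝ))) ^ (2 : ℝ) = a ^ (2 : ℝ) * b := fun a b => by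
    rw [ENNReal.mul_rpow_of_nonneg _ _ zero_le_two, ← ENNReal.rpow_mul]; norm_num
  simp_rw [e]
  refine (ENNReal.lintegral_mul_le_Lp_mul_Lq volume Real.HolderConjugate.two_two
    (hh.enorm.mul hs).aemeasurable (hd.mul hs).aemeasurable).trans (le_of_eq ?_)
  simp only [Pi.mul_apply, e2]

lemma lintegral_extension_le {p q M A : ℝ} (hρm : Measurable ρ)
    (hρ0 : ∀ w, 0 ≤ ρ w) (hρM : ∀ w, ρ w ≤ M) (hM : 0 < M) (hρi : Integrable ρ) (hp : 2 < p)
    (hq : 2 < q) (hpq : 2 / p + 2 / q = 1)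
    (hA0 : 0 < A) (hA : ∀ t : ℝ, t ≠ 0 → ∀ x, ‖∫ w, wave t x w * ρ w‖ ≤ A / |t|)
    {h : ℂ → ℂ} (hh : Measurable h) (hi : Integrable fun w => (ρ w : ℂ) * h w) :
    (∫⁻ t, (∫⁻ x, ‖extension (fun w => (ρ w : ℂ) * h w) (t, x)‖ₑ ^ q) ^ (p / q)) ^ (1 / p) ≤
      ENNReal.ofReal (strichartzConst p q M A) ^ (1 / (2 : ℝ)) *
        (∫⁻ w, ‖h w‖ₑ ^ (2 : ℝ) * ENNReal.ofReal (ρ w)) ^ (1 / (2 : ℝ)) := by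
  set H : ℂ → ℂ := fun w => (ρ w : ℂ) * h w with hH
  have hHm : Measurable H := (Complex.measurable_ofReal.comp hρm).mul hh
  have hpp : p.HolderConjugate p.conjExponent := Real.HolderConjugate.conjExponent (by linarith)
  have hqr : q.HolderConjugate q.conjExponent := Real.HolderConjugate.conjExponent (by linarith)
  set T : ℕ → Set (ℝ × ℂ) := fun N => {z | |z.1| ≤ N ∧ ‖z.2‖ ≤ N} with hT
  have hTm : ∀ N, MeasurableSet (T N) := fun N =>
    (measurableSet_le measurable_fst.abs measurable_const).inter
      (measurableSet_le measurable_snd.norm measurable_const)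
  have hum := measurable_extension hHm
  set U : ℕ → ℝ × ℂ → ℂ := fun N => (T N).indicator (extension H) with hU
  have hUm : ∀ N, Measurable (U N) := fun N => hum.indicator (hTm N)
  have hUle : ∀ N z, ‖U N z‖ ≤ ‖extension H z‖ := fun N z => norm_indicator_le_norm_self _ _
  have key : ∀ N, (∫⁻ t, (∫⁻ x, ‖U N (t, x)‖ₑ ^ q) ^ (p / q)) ^ (1 / p) ≤
      ENNReal.ofReal (strichartzConst p q M A) ^ (1 / (2 : ℝ)) *
        (∫⁻ w, ‖h w‖ₑ ^ (2 : ℝ) * ENNReal.ofReal (ρ w)) ^ (1 / (2 : ℝ)) := by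
    intro N
    obtain ⟨Φ, hΦm, hΦi, hΦ1, hΦ2, hΦ0, hUΦ, hI, hΦr, hfin⟩ :=
      exists_dual_function hp hq hpp hqr (hUm N) (B := ∫ w, ‖H w‖) (N := N)
        (fun z => (hUle N z).trans (norm_extension_le H z)) (fun z hz => by
          by_contra hc
          exact hz (indicator_of_notMem (show z ∉ T N from hc) _))
    refine rpow_one_div_le_of_le_mul_rpow hpp hfin ?_
    have hcongr : ∀ z, U N z * Φ z = extension H z * Φ z := by
      intro z
      by_cases hz : z ∈ T N
      · simp only [hU, indicator_of_mem hz]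
      · have : U N z = 0 := indicator_of_notMem hz _
        rw [hΦ0 z this, mul_zero, mul_zero]
    have h1 : ∫⁻ z, ‖U N z * Φ z‖ₑ = ‖∫ w, H w * dualEvol Φ w‖ₑ := by
      rw [← integral_extension_mul hi hΦi, ← integral_congr_ae (ae_of_all _ hcongr),
        integral_congr_ae (ae_of_all _ hUΦ), integral_complex_ofReal, ← ofReal_norm,
        Complex.norm_real, Real.norm_of_nonneg (integral_nonneg fun _ => norm_nonneg _),
        ofReal_integral_norm_eq_lintegral_enorm]
      simp_rw [hcongr]
      refine hΦi.bdd_mul (c := ∫ w, ‖H w‖) hum.aestronglyMeasurable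
        (ae_of_all _ (norm_extension_le H))
    have hdual := lintegral_dualEvol_le hρm hρ0 hρM hM hρi hp hq hpp hqr hpq hA0 hA hΦm hΦi hΦ1 hΦ2
    rw [hΦr] at hdual
    rw [← hI]
    refine (h1.le.trans (enorm_integral_le_lintegral_enorm _)).trans
      ((lintegral_mul_dualEvol_le hρm hρ0 hh hΦm).trans ?_)
    refine (mul_le_mul_right (ENNReal.rpow_le_rpow hdual (by norm_num)) _).trans (le_of_eq ?_)
    rw [ENNReal.mul_rpow_of_nonneg _ _ (by norm_num : (0 : ℝ) ≤ 1 / 2), ← ENNReal.rpow_mul, hI,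
      show 2 / p.conjExponent * (1 / 2) = 1 / p.conjExponent by ring]
    ring
  have hmono : ∀ z, Monotone fun N => ‖U N z‖ₑ := by
    intro z a b hab
    simp only [hU, enorm_indicator_eq_indicator_enorm]
    refine indicator_le_indicator_of_subset (fun v hv => ?_) (fun _ => zero_le) z
    have : (a : ℝ) ≤ b := by exact_mod_cast hab
    exact ⟨hv.1.trans this, hv.2.trans this⟩
  have hlim : ∀ z, Tendsto (fun N => ‖U N z‖ₑ) atTop (𝓝 ‖extension H z‖ₑ) := by
    intro z
    refine tendsto_const_nhds.congr' ?_
    obtain ⟨n, hn⟩ := exists_nat_ge (max |z.1| ‖z.2‖)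
    filter_upwards [eventually_ge_atTop n] with N hN
    have : (n : ℝ) ≤ N := by exact_mod_cast hN
    have hz : z ∈ T N := ⟨(le_max_left _ _).trans (hn.trans this),
      (le_max_right _ _).trans (hn.trans this)⟩
    simp only [hU, indicator_of_mem hz]
  have hq0 : 0 ≤ q := by linarith
  have hpq0 : 0 ≤ p / q := by positivity
  have hsl : ∀ N t, Measurable fun x => ‖U N (t, x)‖ₑ ^ q := fun N t =>
    (((hUm N).comp measurable_prodMk_left).enorm.pow_const q :)
  have hmx : ∀ t, Monotone fun N => ∫⁻ x, ‖U N (t, x)‖ₑ ^ q := fun t a b hab =>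
    lintegral_mono fun x => ENNReal.rpow_le_rpow (hmono _ hab) hq0
  have hx : ∀ t, Tendsto (fun N => ∫⁻ x, ‖U N (t, x)‖ₑ ^ q) atTop
      (𝓝 (∫⁻ x, ‖extension H (t, x)‖ₑ ^ q)) := fun t =>
    lintegral_tendsto_of_tendsto_of_monotone (fun N => (hsl N t).aemeasurable)
      (ae_of_all _ fun x a b hab => ENNReal.rpow_le_rpow (hmono _ hab) hq0)
      (ae_of_all _ fun x => ((ENNReal.continuous_rpow_const).tendsto _).comp (hlim _))
  have ht : Tendsto (fun N => ∫⁻ t, (∫⁻ x, ‖U N (t, x)‖ₑ ^ q) ^ (p / q)) atTop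
      (𝓝 (∫⁻ t, (∫⁻ x, ‖extension H (t, x)‖ₑ ^ q) ^ (p / q))) :=
    lintegral_tendsto_of_tendsto_of_monotone
      (fun N => ((((hUm N).enorm.pow_const q).lintegral_prod_right' (ν := volume)).pow_const
        (p / q)).aemeasurable)
      (ae_of_all _ fun t a b hab => ENNReal.rpow_le_rpow (hmx t hab) hpq0)
      (ae_of_all _ fun t => ((ENNReal.continuous_rpow_const).tendsto _).comp (hx t))
  exact le_of_tendsto' (((ENNReal.continuous_rpow_const).tendsto _).comp ht) key

end

lemma phase_mul {c : ℂ} {s : ℝ} (hc : c ^ 3 = s) (t : ℝ) (x w : ℂ) :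
    phase t x (c * w) = phase (s * t) (x * (starRingEnd ℂ) c) w := by
  have h1 := congrArg Complex.re hc
  have h2 := congrArg Complex.im hc
  simp only [pow_succ, pow_zero, one_mul, Complex.mul_re, Complex.mul_im, Complex.ofReal_re,
    Complex.ofReal_im] at h1 h2
  simp only [phase, phiNV, Complex.mul_re, Complex.mul_im, Complex.conj_re, Complex.conj_im]
  rw [← h1]
  linear_combination (t * (w.im ^ 3 - 3 * w.im * w.re ^ 2)) * (-h2)

lemma wave_mul {c : ℂ} {s : ℝ} (hc : c ^ 3 = s) (t : ℝ) (x w : ℂ) :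
    wave t x (c * w) = wave (s * t) (x * (starRingEnd ℂ) c) w := by
  rw [wave, wave, phase_mul hc]

lemma norm_integral_wave_strip_mul_le {d : ℂ} (hd : d ≠ 0) {s : ℝ} (hs : d ^ 3 = s) {t : ℝ}
    (ht : t ≠ 0) (x : ℂ) :
    ‖∫ w, wave t x w * strip (d * w)‖ ≤ ‖d‖ * (12 * Real.pi / |t|) := by
  have hd' : d⁻¹ ≠ 0 := inv_ne_zero hd
  have hs' : d⁻¹ ^ 3 = ((s⁻¹ : ℝ) : ℂ) := by rw [inv_pow, hs, Complex.ofReal_inv]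
  have hs0 : s ≠ 0 := by
    rintro rfl
    exact pow_ne_zero 3 hd (by simpa using hs)
  have hsn : |s| = ‖d‖ ^ 3 := by
    rw [← norm_pow, hs, Complex.norm_real, Real.norm_eq_abs]
  rw [integral_comp_mul_complex hd']
  have e : ∀ w, wave t x (d⁻¹ * w) * (strip (d * (d⁻¹ * w)) : ℂ) =
      wave (s⁻¹ * t) (x * (starRingEnd ℂ) d⁻¹) w * strip w := fun w => by
    rw [wave_mul hs', mul_inv_cancel_left₀ hd]
  simp_rw [e]
  rw [norm_smul, Real.norm_of_nonneg (by positivity)]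
  refine (mul_le_mul_of_nonneg_left (norm_integral_wave_strip_le
    (mul_ne_zero (inv_ne_zero hs0) ht) _) (by positivity)).trans (le_of_eq ?_)
  rw [abs_mul, abs_inv, hsn, norm_inv]
  have := norm_ne_zero_iff.2 hd
  have := abs_ne_zero.2 ht
  field_simp

/-- The sixth roots of unity. -/
noncomputable def dir : Fin 6 → ℂ :=
  ![1, ⟨1 / 2, √3 / 2⟩, ⟨-1 / 2, √3 / 2⟩, -1, ⟨-1 / 2, -√3 / 2⟩, ⟨1 / 2, -√3 / 2⟩]

lemma exists_dir_pow_three (j : Fin 6) : ∃ s : ℝ, dir j ^ 3 = s := by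
  have h3 : √3 ^ 3 = 3 * √3 := by rw [pow_succ, Real.sq_sqrt (by norm_num)]
  refine ⟨(dir j ^ 3).re, Complex.ext (by simp) ?_⟩
  fin_cases j <;> simp [dir, pow_succ] <;> linarith [h3]

lemma norm_dir (j : Fin 6) : ‖dir j‖ = 1 := by
  have h3 : √3 ^ 2 = 3 := Real.sq_sqrt (by norm_num)
  have : Complex.normSq (dir j) = 1 := by
    fin_cases j <;> simp [dir, Complex.normSq_apply] <;> nlinarith
  rw [Complex.normSq_eq_norm_sq] at this
  exact (pow_eq_one_iff_of_nonneg (norm_nonneg _) two_ne_zero).1 this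

lemma exists_half_le_re_dir_mul {v : ℂ} (hv : 1 ≤ ‖v‖) : ∃ j, 1 / 2 ≤ (dir j * v).re := by
  by_contra! h
  have h3 : √3 ^ 2 = 3 := Real.sq_sqrt (by norm_num)
  have hn : 1 ≤ v.re ^ 2 + v.im ^ 2 := by
    have := Complex.normSq_eq_norm_sq v
    rw [Complex.normSq_apply] at this
    nlinarith
  have a0 := h 0
  have a1 := h 1
  have a2 := h 2
  have a3 := h 3
  have a4 := h 4
  have a5 := h 5
  simp [dir] at a0 a1 a2 a3 a4 a5
  have b0 : v.re ^ 2 ≤ 1 / 4 := by nlinarith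
  have b1 : (v.re / 2 - √3 / 2 * v.im) ^ 2 ≤ 1 / 4 := by
    nlinarith
  have b2 : (v.re / 2 + √3 / 2 * v.im) ^ 2 ≤ 1 / 4 := by
    nlinarith
  nlinarith

/-- The constant bounding the dyadic weights from below on their annuli. -/
noncomputable def stripConst : ℝ := √(1 / 2) * Real.exp (-8)

lemma stripConst_pos : 0 < stripConst := by unfold stripConst; positivity

lemma stripConst_le_strip {w : ℂ} (h1 : 1 / 2 ≤ w.re) (h2 : ‖w‖ ≤ 2) : stripConst ≤ strip w := by
  have hre : w.re ≤ 2 := (Complex.re_le_norm w).trans h2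
  have him : w.im ^ 2 ≤ 4 := by
    have := abs_le.1 ((Complex.abs_im_le_norm w).trans h2)
    nlinarith
  rw [strip, indicator_of_mem (mem_Icc.2 ⟨h1, hre⟩), stripConst]
  gcongr
  nlinarith [sq_nonneg w.im]

/-- A frequency cutoff dominating the annulus `2 ^ k ≤ ‖w‖ < 2 ^ (k + 1)`. -/
noncomputable def weight (k : ℤ) (w : ℂ) : ℝ := ∑ j, strip (dir j * 2 ^ (-k) * w)

lemma dir_mul_ne_zero (j : Fin 6) (k : ℤ) : dir j * 2 ^ (-k) ≠ 0 := by
  refine mul_ne_zero (fun h => ?_) (zpow_ne_zero _ two_ne_zero)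
  simpa [h] using norm_dir j

lemma measurable_weight (k : ℤ) : Measurable (weight k) :=
  Finset.measurable_sum _ fun _ _ => measurable_strip.comp (measurable_const_mul _)

lemma weight_nonneg (k : ℤ) (w : ℂ) : 0 ≤ weight k w :=
  Finset.sum_nonneg fun _ _ => strip_nonneg _

lemma weight_le (k : ℤ) (w : ℂ) : weight k w ≤ 12 := by
  refine (Finset.sum_le_card_nsmul _ _ 2 fun _ _ => strip_le _).trans (le_of_eq ?_)
  norm_num

lemma integrable_strip_comp (j : Fin 6) (k : ℤ) :
    Integrable fun w => strip (dir j * 2 ^ (-k) * w) := by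
  have hm : Measurable fun w => strip (dir j * 2 ^ (-k) * w) :=
    measurable_strip.comp (measurable_const_mul _)
  refine ⟨hm.aestronglyMeasurable, ?_⟩
  have h := lintegral_comp_mul_complex (dir_mul_ne_zero j k) fun w => ‖strip w‖ₑ
  by_contra hc
  have hfin := integrable_strip.2
  rw [HasFiniteIntegral, not_lt, top_le_iff] at hc
  rw [HasFiniteIntegral, h, hc, ENNReal.mul_top] at hfin
  · exact lt_irrefl _ hfin
  · have := norm_pos_iff.2 (dir_mul_ne_zero j k)
    exact (ENNReal.ofReal_pos.2 (by positivity)).ne'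

lemma integrable_weight (k : ℤ) : Integrable (weight k) :=
  integrable_finsetSum _ fun j _ => integrable_strip_comp j k

lemma norm_integral_wave_weight_le (k : ℤ) {t : ℝ} (ht : t ≠ 0) (x : ℂ) :
    ‖∫ w, wave t x w * weight k w‖ ≤ 72 * Real.pi * 2 ^ (-k) / |t| := by
  have e : ∫ w, wave t x w * weight k w =
      ∑ j, ∫ w, wave t x w * strip (dir j * 2 ^ (-k) * w) := by
    rw [← integral_finsetSum]
    · refine integral_congr_ae (ae_of_all _ fun w => ?_)
      simp only [weight, Complex.ofReal_sum, Finset.mul_sum]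
    · exact fun j _ => ((integrable_strip_comp j k).ofReal (𝕜 := ℂ)).bdd_mul (c := 1)
        (measurable_wave_right t x).aestronglyMeasurable (ae_of_all _ fun _ => (norm_wave ..).le)
  rw [e]
  refine (norm_sum_le _ _).trans ((Finset.sum_le_card_nsmul _ _
    (2 ^ (-k) * (12 * Real.pi / |t|)) fun j _ => ?_).trans (le_of_eq ?_))
  · obtain ⟨s, hs⟩ := exists_dir_pow_three j
    have h3 : (dir j * 2 ^ (-k)) ^ 3 = ((s * (2 ^ (-k)) ^ 3 : ℝ) : ℂ) := by
      rw [mul_pow, hs]; push_cast; rfl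
    refine (norm_integral_wave_strip_mul_le (dir_mul_ne_zero j k) h3 ht x).trans (le_of_eq ?_)
    rw [norm_mul, norm_dir, one_mul, norm_zpow]
    simp
  · simp; ring

lemma stripConst_le_weight {k : ℤ} {w : ℂ} (h1 : (2 : ℝ) ^ k ≤ ‖w‖) (h2 : ‖w‖ < 2 ^ (k + 1)) :
    stripConst ≤ weight k w := by
  have h0 : (0 : ℝ) < 2 ^ k := by positivity
  have hn : ‖(2 : ℂ) ^ (-k) * w‖ = ‖w‖ / 2 ^ k := by
    rw [norm_mul, norm_zpow, zpow_neg]; simp [div_eq_inv_mul]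
  have hv1 : 1 ≤ ‖(2 : ℂ) ^ (-k) * w‖ := by rwa [hn, one_le_div h0]
  have hv2 : ‖(2 : ℂ) ^ (-k) * w‖ ≤ 2 := by
    rw [hn, div_le_iff₀ h0]
    rw [zpow_add_one₀ two_ne_zero] at h2
    linarith
  obtain ⟨j, hj⟩ := exists_half_le_re_dir_mul hv1
  refine (stripConst_le_strip (w := dir j * 2 ^ (-k) * w) (by rwa [mul_assoc]) ?_).trans
    (Finset.single_le_sum (fun i _ => strip_nonneg (dir i * 2 ^ (-k) * w)) (Finset.mem_univ j))
  rw [mul_assoc, norm_mul, norm_dir, one_mul]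
  exact hv2

/-- The dyadic annulus `2 ^ k ≤ ‖w‖ < 2 ^ (k + 1)`. -/
def ann (k : ℤ) : Set ℂ := {w | (2 : ℝ) ^ k ≤ ‖w‖ ∧ ‖w‖ < 2 ^ (k + 1)}

lemma measurableSet_ann (k : ℤ) : MeasurableSet (ann k) :=
  (measurableSet_le measurable_const measurable_norm).inter
    (measurableSet_lt measurable_norm measurable_const)

/-- The constant in the Strichartz estimate for functions with frequencies in an annulus. -/
noncomputable def annConst (p q : ℝ) : ℝ :=
  (strichartzConst p q 12 (72 * Real.pi) / stripConst) ^ (1 / (2 : ℝ))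

lemma strichartzConst_nonneg {p q M A : ℝ} (hp : 2 < p) (hq : 2 < q) (hM : 0 < M) (hA : 0 ≤ A) :
    0 ≤ strichartzConst p q M A := by
  have := dispConst_pos hq hM
  have : 0 < 1 - 2 / p := by rw [sub_pos, div_lt_one (by linarith)]; exact hp
  unfold strichartzConst
  positivity

lemma lintegral_extension_ann_le {p q : ℝ} (hp : 2 < p) (hq : 2 < q) (hpq : 2 / p + 2 / q = 1)
    {G : ℂ → ℂ} (hG : Measurable G) (hGi : Integrable G) (k : ℤ) :
    (∫⁻ t, (∫⁻ x, ‖extension ((ann k).indicator G) (t, x)‖ₑ ^ q) ^ (p / q)) ^ (1 / p) ≤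
      ENNReal.ofReal (annConst p q * 2 ^ (-k / p : ℝ)) *
        (∫⁻ w in ann k, ‖G w‖ₑ ^ (2 : ℝ)) ^ (1 / (2 : ℝ)) := by
  set H := (ann k).indicator G with hH
  have hHm : Measurable H := hG.indicator (measurableSet_ann k)
  set h : ℂ → ℂ := fun w => H w / weight k w with hh
  have hhm : Measurable h := hHm.div (Complex.measurable_ofReal.comp (measurable_weight k))
  have hc := stripConst_pos
  have hpos : ∀ w ∈ ann k, stripConst ≤ weight k w := fun w hw => stripConst_le_weight hw.1 hw.2
  have he : (fun w => (weight k w : ℂ) * h w) = H := by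
    ext w
    by_cases hw : w ∈ ann k
    · have : (weight k w : ℂ) ≠ 0 := by exact_mod_cast (hc.trans_le (hpos w hw)).ne'
      simp only [hh]; field_simp
    · simp [hh, hH, hw]
  have hA : (0 : ℝ) < 72 * Real.pi * 2 ^ (-k) := by positivity
  have := lintegral_extension_le (measurable_weight k) (weight_nonneg k) (weight_le k) (by norm_num)
    (integrable_weight k) hp hq hpq hA (fun t ht x => norm_integral_wave_weight_le k ht x) hhm
    (by rw [he]; exact hGi.indicator (measurableSet_ann k))
  rw [he] at this
  refine this.trans ?_
  have h2 : ∫⁻ w, ‖h w‖ₑ ^ (2 : ℝ) * ENNReal.ofReal (weight k w) ≤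
      ENNReal.ofReal stripConst⁻¹ * ∫⁻ w in ann k, ‖G w‖ₑ ^ (2 : ℝ) := by
    rw [← lintegral_indicator (measurableSet_ann k), ← lintegral_const_mul' _ _ (by simp)]
    refine lintegral_mono fun w => ?_
    by_cases hw : w ∈ ann k
    · have hw0 := hc.trans_le (hpos w hw)
      simp only [hh, hH, indicator_of_mem hw]
      rw [← ofReal_norm, ← ofReal_norm, ENNReal.ofReal_rpow_of_nonneg (norm_nonneg _) zero_le_two,
        ENNReal.ofReal_rpow_of_nonneg (norm_nonneg _) zero_le_two, ← ENNReal.ofReal_mul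
        (by positivity), ← ENNReal.ofReal_mul (by positivity)]
      refine ENNReal.ofReal_le_ofReal ?_
      rw [norm_div, Complex.norm_real, Real.norm_of_nonneg hw0.le, Real.rpow_two, Real.rpow_two]
      have e : (‖G w‖ / weight k w) ^ 2 * weight k w = (weight k w)⁻¹ * ‖G w‖ ^ 2 := by
        field_simp
      rw [e]
      gcongr
      exact hpos w hw
    · simp [hh, hH, hw]
  refine (mul_le_mul_right (ENNReal.rpow_le_rpow h2 (by norm_num)) _).trans (le_of_eq ?_)
  rw [ENNReal.mul_rpow_of_nonneg _ _ (by norm_num : (0 : ℝ) ≤ 1 / 2), ← mul_assoc]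
  congr 1
  have hs := strichartzConst_nonneg hp hq (by norm_num : (0 : ℝ) < 12)
    (by positivity : 0 ≤ 72 * Real.pi)
  have e : strichartzConst p q 12 (72 * Real.pi * 2 ^ (-k)) =
      strichartzConst p q 12 (72 * Real.pi) * 2 ^ (-k * (2 / p) : ℝ) := by
    unfold strichartzConst
    rw [Real.mul_rpow (by positivity) (by positivity), ← Real.rpow_intCast, ← Real.rpow_mul
      zero_le_two]
    push_cast
    ring
  rw [← ENNReal.mul_rpow_of_nonneg _ _ (by norm_num : (0 : ℝ) ≤ 1 / 2), ← ENNReal.ofReal_mul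
    (by rw [e]; positivity), ENNReal.ofReal_rpow_of_nonneg (by rw [e]; positivity) (by norm_num),
    annConst, e]
  congr 1
  rw [div_eq_mul_inv, mul_right_comm, Real.mul_rpow (by positivity) (by positivity),
    ← Real.rpow_mul zero_le_two]
  congr 2
  ring

lemma lintegral_rpow_sum_le {α ι : Type*} [MeasurableSpace α] {μ : Measure α} {a : ℝ} (ha : 1 ≤ a)
    {f : ι → α → ℝ≥0∞} (hf : ∀ i, Measurable (f i)) (s : Finset ι) :
    (∫⁻ x, (∑ i ∈ s, f i x) ^ a ∂μ) ^ (1 / a) ≤ ∑ i ∈ s, (∫⁻ x, f i x ^ a ∂μ) ^ (1 / a) := by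
  have ha0 : 0 < a := by linarith
  classical
  induction s using Finset.induction_on with
  | empty => simp [ha0]
  | insert i s hi ih =>
    simp_rw [Finset.sum_insert hi]
    refine (ENNReal.lintegral_Lp_add_le (hf i).aemeasurable
      (Finset.measurable_sum s fun j _ => hf j).aemeasurable ha).trans ?_
    gcongr

lemma lintegral_rpow_tsum_le {α ι : Type*} [Countable ι] [MeasurableSpace α] {μ : Measure α} {a : ℝ}
    (ha : 1 ≤ a) {f : ι → α → ℝ≥0∞} (hf : ∀ i, Measurable (f i)) :
    (∫⁻ x, (∑' i, f i x) ^ a ∂μ) ^ (1 / a) ≤ ∑' i, (∫⁻ x, f i x ^ a ∂μ) ^ (1 / a) := by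
  have ha0 : 0 < a := by linarith
  have e : ∀ x, (∑' i, f i x) ^ a = ⨆ s : Finset ι, (∑ i ∈ s, f i x) ^ a := fun x => by
    rw [ENNReal.tsum_eq_iSup_sum]
    exact (ENNReal.orderIsoRpow a ha0).map_iSup _
  simp_rw [e]
  rw [lintegral_iSup_directed (fun s => ((Finset.measurable_sum s fun i _ => hf i).pow_const
    a).aemeasurable)]
  · rw [show ∀ b : ℝ≥0∞, b ^ (1 / a) = ENNReal.orderIsoRpow (1 / a) (by positivity) b from
      fun _ => rfl, OrderIso.map_iSup]
    exact iSup_le fun s => (lintegral_rpow_sum_le ha hf s).trans (ENNReal.sum_le_tsum s)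
  · refine directed_of_isDirected_le fun s s' hs x => ?_
    exact ENNReal.rpow_le_rpow (Finset.sum_le_sum_of_subset hs) ha0.le

/-- The mixed space-time norm `L^p_t L^q_x`. -/
noncomputable def mixedNorm (p q : ℝ) (F : ℝ × ℂ → ℝ≥0∞) : ℝ≥0∞ :=
  (∫⁻ t, (∫⁻ x, F (t, x) ^ q) ^ (p / q)) ^ (1 / p)

lemma mixedNorm_eq (p q : ℝ) (F : ℝ × ℂ → ℝ≥0∞) :
    mixedNorm p q F = (∫⁻ t, ((∫⁻ x, F (t, x) ^ q) ^ (1 / q)) ^ p) ^ (1 / p) := by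
  simp_rw [← ENNReal.rpow_mul, mixedNorm]
  congr! 4
  ring

lemma mixedNorm_mono {p q : ℝ} (hp : 0 < p) (hq : 0 < q) {F G : ℝ × ℂ → ℝ≥0∞}
    (h : ∀ z, F z ≤ G z) : mixedNorm p q F ≤ mixedNorm p q G := by
  unfold mixedNorm
  gcongr
  exact h _

lemma measurable_slice_norm {F : ℝ × ℂ → ℝ≥0∞} (hF : Measurable F) (q : ℝ) :
    Measurable fun t => (∫⁻ x, F (t, x) ^ q) ^ (1 / q) :=
  ((((hF.pow_const q).lintegral_prod_right' (ν := volume)).pow_const (1 / q)) :)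

lemma mixedNorm_tsum_le {ι : Type*} [Countable ι] {p q : ℝ} (hp : 1 ≤ p) (hq : 1 ≤ q)
    {F : ι → ℝ × ℂ → ℝ≥0∞} (hF : ∀ i, Measurable (F i)) :
    mixedNorm p q (fun z => ∑' i, F i z) ≤ ∑' i, mixedNorm p q (F i) := by
  simp_rw [mixedNorm_eq]
  refine le_trans ?_ (lintegral_rpow_tsum_le hp fun i => measurable_slice_norm (hF i) q)
  gcongr with t
  exact lintegral_rpow_tsum_le hq fun i => (hF i).comp measurable_prodMk_left

lemma mixedNorm_mul_le {a b p₁ p₂ q₁ q₂ : ℝ} (ha : 0 < a) (hb : 0 < b) (hap : a < p₁) (hbq : b < q₁)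
    (hp : 1 / a = 1 / p₁ + 1 / p₂) (hq : 1 / b = 1 / q₁ + 1 / q₂) {F G : ℝ × ℂ → ℝ≥0∞}
    (hF : Measurable F) (hG : Measurable G) :
    mixedNorm a b (fun z => F z * G z) ≤ mixedNorm p₁ q₁ F * mixedNorm p₂ q₂ G := by
  simp_rw [mixedNorm_eq]
  refine le_trans ?_ (ENNReal.lintegral_Lp_mul_le_Lq_mul_Lr ha hap hp volume
    (measurable_slice_norm hF q₁).aemeasurable (measurable_slice_norm hG q₂).aemeasurable)
  gcongr with t
  exact ENNReal.lintegral_Lp_mul_le_Lq_mul_Lr hb hbq hq volume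
    (hF.comp measurable_prodMk_left).aemeasurable (hG.comp measurable_prodMk_left).aemeasurable

lemma mixedNorm_mul_self (p q : ℝ) (F : ℝ × ℂ → ℝ≥0∞) :
    mixedNorm (p / 2) (q / 2) (fun z => F z * F z) = mixedNorm p q F ^ (2 : ℝ) := by
  have e : ∀ z, (F z * F z) ^ (q / 2) = F z ^ q := fun z => by
    rw [← sq, ← ENNReal.rpow_natCast, ← ENNReal.rpow_mul]; congr 1; push_cast; ring
  unfold mixedNorm
  simp_rw [e, ← ENNReal.rpow_mul]
  rw [show p / 2 / (q / 2) = p / q by ring]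
  congr 1
  ring

/-- Almost orthogonality: square-summing pieces whose mixed norms obey matching bounds. -/
lemma mixedNorm_tsum_rpow_two_le {p q : ℝ} (hp : 2 < p) (hq : 2 < q) {v : ℤ → ℝ × ℂ → ℝ≥0∞}
    (hv : ∀ k, Measurable (v k)) {K : ℤ → ℝ≥0∞} {c : ℤ → ℝ≥0∞}
    (hKc : ∀ k l, k ≤ l → mixedNorm (p / 2) (q / 2) (fun z => v k z * v l z) ≤
      K (l - k) * (c k * c l)) :
    mixedNorm p q (fun z => ∑' k, v k z) ^ (2 : ℝ) ≤
      (4 * ∑' m, K m) * ∑' k, c k ^ (2 : ℝ) := by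
  have hb : ∀ k l, mixedNorm (p / 2) (q / 2) (fun z => v k z * v l z) ≤
      (K (l - k) + K (k - l)) * (c k ^ (2 : ℝ) + c l ^ (2 : ℝ)) := by
    intro k l
    have hcc : c k * c l ≤ c k ^ (2 : ℝ) + c l ^ (2 : ℝ) := by
      simp only [ENNReal.rpow_two, sq]
      rcases le_total (c k) (c l) with h | h
      · exact (mul_le_mul_left h _).trans le_add_self
      · exact (mul_le_mul_right h _).trans le_self_add
    rcases le_total k l with h | h
    · exact (hKc k l h).trans (mul_le_mul' le_self_add hcc)
    · simp_rw [mul_comm (v k _)]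
      refine (hKc l k h).trans (mul_le_mul' le_add_self ?_)
      rwa [mul_comm]
  have hS1 : ∀ k, ∑' l, (K (l - k) + K (k - l)) = 2 * ∑' m, K m := fun k => by
    have h1 : ∑' l, K (l - k) = ∑' m, K m := (Equiv.subRight k).tsum_eq K
    have h2 : ∑' l, K (k - l) = ∑' m, K m := (Equiv.subLeft k).tsum_eq K
    rw [ENNReal.tsum_add, h1, h2, two_mul]
  have hS2 : ∀ l, ∑' k, (K (l - k) + K (k - l)) = 2 * ∑' m, K m := fun k => by
    rw [← hS1 k]; exact tsum_congr fun _ => add_comm _ _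
  calc mixedNorm p q (fun z => ∑' k, v k z) ^ (2 : ℝ)
      = mixedNorm (p / 2) (q / 2) (fun z => ∑' i : ℤ × ℤ, v i.1 z * v i.2 z) := by
        rw [← mixedNorm_mul_self]
        congr 1
        ext z
        rw [ENNReal.tsum_prod (f := fun k l => v k z * v l z), ← ENNReal.tsum_mul_right]
        simp_rw [ENNReal.tsum_mul_left]
    _ ≤ ∑' i : ℤ × ℤ, mixedNorm (p / 2) (q / 2) fun z => v i.1 z * v i.2 z :=
        mixedNorm_tsum_le (by linarith) (by linarith) fun i => (hv i.1).mul (hv i.2)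
    _ ≤ ∑' i : ℤ × ℤ, (K (i.2 - i.1) + K (i.1 - i.2)) * (c i.1 ^ (2 : ℝ) + c i.2 ^ (2 : ℝ)) :=
        ENNReal.tsum_le_tsum fun i => hb _ _
    _ = (∑' k, ∑' l, (K (l - k) + K (k - l)) * c k ^ (2 : ℝ)) +
          ∑' l, ∑' k, (K (l - k) + K (k - l)) * c l ^ (2 : ℝ) := by
        rw [ENNReal.tsum_comm (f := fun l k => (K (l - k) + K (k - l)) * c l ^ (2 : ℝ)),
          ENNReal.tsum_prod (f := fun k l => (K (l - k) + K (k - l)) *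
            (c k ^ (2 : ℝ) + c l ^ (2 : ℝ))), ← ENNReal.tsum_add]
        simp_rw [← ENNReal.tsum_add, mul_add]
    _ = (4 * ∑' m, K m) * ∑' k, c k ^ (2 : ℝ) := by
        simp_rw [ENNReal.tsum_mul_right, hS1, hS2, ENNReal.tsum_mul_left]
        rw [← add_mul, ← add_mul]
        norm_num

lemma pairwise_disjoint_ann : Pairwise (Function.onFun Disjoint ann) := by
  have key : ∀ k l : ℤ, k < l → Disjoint (ann k) (ann l) := by
    intro k l hkl
    refine Set.disjoint_left.2 fun w hk hl => ?_
    have : (2 : ℝ) ^ (k + 1) ≤ 2 ^ l := zpow_le_zpow_right₀ one_le_two hkl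
    exact absurd (hk.2.trans_le (this.trans hl.1)) (lt_irrefl _)
  intro k l hkl
  rcases hkl.lt_or_gt with h | h
  · exact key k l h
  · exact (key l k h).symm

lemma iUnion_ann : ⋃ k, ann k = {0}ᶜ := by
  ext w
  simp only [mem_iUnion, mem_compl_iff, mem_singleton_iff]
  refine ⟨?_, fun h => ?_⟩
  · rintro ⟨k, hk⟩ rfl
    have := hk.1
    rw [norm_zero] at this
    exact absurd this (not_le.2 (by positivity))
  · exact exists_mem_Ico_zpow (norm_pos_iff.2 h) one_lt_two

lemma enorm_extension_le_tsum {G : ℂ → ℂ} (hGi : Integrable G) (z : ℝ × ℂ) :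
    ‖extension G z‖ₑ ≤ ∑' k, ‖extension ((ann k).indicator G) z‖ₑ := by
  have hi : Integrable fun w => wave z.1 z.2 w * G w :=
    hGi.bdd_mul (c := 1) (measurable_wave_right _ _).aestronglyMeasurable
      (ae_of_all _ fun _ => (norm_wave ..).le)
  have h := hasSum_integral_iUnion measurableSet_ann pairwise_disjoint_ann hi.integrableOn
  have e1 : ∫ w in ⋃ k, ann k, wave z.1 z.2 w * G w = extension G z := by
    rw [iUnion_ann, restrict_compl_singleton, extension]
  have e2 : ∀ k, ∫ w in ann k, wave z.1 z.2 w * G w = extension ((ann k).indicator G) z := by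
    intro k
    rw [← integral_indicator (measurableSet_ann k), extension]
    refine integral_congr_ae (ae_of_all _ fun w => ?_)
    by_cases hw : w ∈ ann k <;> simp [hw]
  rw [e1] at h
  simp_rw [e2] at h
  rw [← h.tsum_eq]
  exact enorm_tsum_le_tsum_enorm

lemma setLIntegral_ann_le {σ : ℝ} (hσ : 0 < σ) (g : ℂ → ℂ) (k : ℤ) :
    (∫⁻ w in ann k, ‖((‖w‖ ^ σ : ℝ) : ℂ) * g w‖ₑ ^ (2 : ℝ)) ^ (1 / (2 : ℝ)) ≤
      ENNReal.ofReal (2 ^ ((k + 1) * σ : ℝ)) *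
        (∫⁻ w in ann k, ‖g w‖ₑ ^ (2 : ℝ)) ^ (1 / (2 : ℝ)) := by
  have h : ∫⁻ w in ann k, ‖((‖w‖ ^ σ : ℝ) : ℂ) * g w‖ₑ ^ (2 : ℝ) ≤
      ENNReal.ofReal (2 ^ ((k + 1) * σ : ℝ)) ^ (2 : ℝ) * ∫⁻ w in ann k, ‖g w‖ₑ ^ (2 : ℝ) := by
    rw [← lintegral_const_mul' _ _ (by finiteness)]
    refine setLIntegral_mono' (measurableSet_ann k) fun w hw => ?_
    rw [← ENNReal.mul_rpow_of_nonneg _ _ zero_le_two, enorm_mul]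
    gcongr
    rw [← ofReal_norm, Complex.norm_real, Real.norm_of_nonneg (by positivity)]
    refine ENNReal.ofReal_le_ofReal ?_
    rw [Real.rpow_mul zero_le_two]
    refine Real.rpow_le_rpow (norm_nonneg _) ?_ hσ.le
    have := hw.2.le
    rw [← Real.rpow_intCast] at this
    simpa using this
  refine (ENNReal.rpow_le_rpow h (by norm_num)).trans (le_of_eq ?_)
  rw [ENNReal.mul_rpow_of_nonneg _ _ (by norm_num : (0 : ℝ) ≤ 1 / 2), ← ENNReal.rpow_mul]
  norm_num

lemma tsum_ofReal_two_rpow_ne_top {δ : ℝ} (hδ : 0 < δ) :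
    ∑' m : ℤ, ENNReal.ofReal (2 ^ (-δ * |(m : ℝ)|)) ≠ ∞ := by
  have hs : Summable fun n : ℕ => ((2 : ℝ) ^ (-δ)) ^ n :=
    summable_geometric_of_lt_one (by positivity)
      (Real.rpow_lt_one_of_one_lt_of_neg one_lt_two (by linarith))
  have hs' : Summable fun m : ℤ => (2 : ℝ) ^ (-δ * |(m : ℝ)|) := by
    refine Summable.of_nat_of_neg (hs.congr fun n => ?_) (hs.congr fun n => ?_) <;>
    · push_cast
      rw [← Real.rpow_natCast, ← Real.rpow_mul zero_le_two]
      simp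
  rw [← ENNReal.ofReal_tsum_of_nonneg (fun m => by positivity) hs']
  exact ENNReal.ofReal_ne_top

lemma exists_mixedNorm_extension_le {p q : ℝ} (hp : 2 < p) (hq : 2 < q)
    (hpq : 2 / p + 2 / q = 1) :
    ∃ C > (0 : ℝ), ∀ g : ℂ → ℂ, Measurable g →
      Integrable (fun w => ((‖w‖ ^ (1 / p) : ℝ) : ℂ) * g w) →
      mixedNorm p q (fun z => ‖extension (fun w => ((‖w‖ ^ (1 / p) : ℝ) : ℂ) * g w) z‖ₑ) ≤
        ENNReal.ofReal C * (∫⁻ w, ‖g w‖ₑ ^ (2 : ℝ)) ^ (1 / (2 : ℝ)) := by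
  have hp0 : 0 < 1 / p := by positivity
  have hq0 : 0 < 1 / q := by positivity
  have hpq' : 1 / p + 1 / q = 1 / 2 := by
    have h1 : 2 / p = 2 * (1 / p) := by ring
    have h2 : 2 / q = 2 * (1 / q) := by ring
    linarith
  obtain ⟨δ, hδ, hδp, hδq⟩ : ∃ δ, 0 < δ ∧ δ < 1 / p ∧ δ < 1 / q := by
    refine ⟨min (1 / p) (1 / q) / 2, by positivity, ?_, ?_⟩
    · have := min_le_left (1 / p) (1 / q); linarith
    · have := min_le_right (1 / p) (1 / q); linarith
  have hlt : ∀ {a b : ℝ}, 0 < a → a < b → b⁻¹ < a⁻¹ := fun ha hab => inv_strictAnti₀ ha hab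
  have htwo : ∀ {a : ℝ}, 0 < a → a < 1 / 2 → 2 < a⁻¹ := fun ha h => by
    have := hlt ha h; norm_num at this; exact this
  set p₁ := (1 / p - δ)⁻¹ with hp₁
  set q₁ := (1 / q + δ)⁻¹ with hq₁
  set p₂ := (1 / p + δ)⁻¹ with hp₂
  set q₂ := (1 / q - δ)⁻¹ with hq₂
  have h2p₁ : 2 < p₁ := htwo (by linarith) (by linarith)
  have h2q₁ : 2 < q₁ := htwo (by linarith) (by linarith)
  have h2p₂ : 2 < p₂ := htwo (by linarith) (by linarith)
  have h2q₂ : 2 < q₂ := htwo (by linarith) (by linarith)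
  have hpq₁ : 2 / p₁ + 2 / q₁ = 1 := by
    rw [hp₁, hq₁, div_inv_eq_mul, div_inv_eq_mul]; linarith
  have hpq₂ : 2 / p₂ + 2 / q₂ = 1 := by
    rw [hp₂, hq₂, div_inv_eq_mul, div_inv_eq_mul]; linarith
  have ha : p / 2 < p₁ := by
    have := hlt (a := 1 / p - δ) (b := 2 * (1 / p)) (by linarith) (by linarith)
    refine lt_of_eq_of_lt ?_ this
    field_simp
  have hb : q / 2 < q₁ := by
    have := hlt (a := 1 / q + δ) (b := 2 * (1 / q)) (by linarith) (by linarith)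
    refine lt_of_eq_of_lt ?_ this
    field_simp
  have ha' : 1 / (p / 2) = 1 / p₁ + 1 / p₂ := by
    rw [hp₁, hp₂, one_div_div, div_inv_eq_mul, div_inv_eq_mul]; ring
  have hb' : 1 / (q / 2) = 1 / q₁ + 1 / q₂ := by
    rw [hq₁, hq₂, one_div_div, div_inv_eq_mul, div_inv_eq_mul]; ring
  have hnn : ∀ {a b : ℝ}, 2 < a → 2 < b → 0 ≤ annConst a b := fun ha hb => by
    have := strichartzConst_nonneg ha hb (by norm_num : (0 : ℝ) < 12)
      (by positivity : 0 ≤ 72 * Real.pi)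
    have := stripConst_pos
    unfold annConst; positivity
  have hA₁ := hnn h2p₁ h2q₁
  have hA₂ := hnn h2p₂ h2q₂
  set D := annConst p₁ q₁ * annConst p₂ q₂ * 2 ^ (2 / p) with hD
  have hD0 : 0 ≤ D := by positivity
  set K : ℤ → ℝ≥0∞ := fun m => ENNReal.ofReal D * ENNReal.ofReal (2 ^ (-δ * |(m : ℝ)|)) with hK
  have hKtop : 4 * ∑' m, K m ≠ ∞ := by
    rw [ENNReal.tsum_mul_left]
    exact ENNReal.mul_ne_top (by norm_num)
      (ENNReal.mul_ne_top ENNReal.ofReal_ne_top (tsum_ofReal_two_rpow_ne_top hδ))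
  refine ⟨((4 * ∑' m, K m) ^ (1 / (2 : ℝ))).toReal + 1, by positivity, fun g hg hGi => ?_⟩
  set G : ℂ → ℂ := fun w => ((‖w‖ ^ (1 / p) : ℝ) : ℂ) * g w with hG
  have hGm : Measurable G :=
    (Complex.measurable_ofReal.comp (measurable_norm.pow_const (1 / p))).mul hg
  set v : ℤ → ℝ × ℂ → ℝ≥0∞ := fun k z => ‖extension ((ann k).indicator G) z‖ₑ with hv
  have hvm : ∀ k, Measurable (v k) := fun k =>
    (measurable_extension (hGm.indicator (measurableSet_ann k))).enorm
  set c : ℤ → ℝ≥0∞ := fun k => (∫⁻ w in ann k, ‖g w‖ₑ ^ (2 : ℝ)) ^ (1 / (2 : ℝ)) with hc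
  have hvk : ∀ {a b : ℝ}, 2 < a → 2 < b → 2 / a + 2 / b = 1 → ∀ k, mixedNorm a b (v k) ≤
      ENNReal.ofReal (annConst a b * 2 ^ (-k / a : ℝ) * 2 ^ ((k + 1) * (1 / p) : ℝ)) * c k := by
    intro a b h2a h2b hab k
    refine (lintegral_extension_ann_le h2a h2b hab hGm hGi k).trans ?_
    refine (mul_le_mul_right (setLIntegral_ann_le hp0 g k) _).trans (le_of_eq ?_)
    have := hnn h2a h2b
    rw [← mul_assoc, ← ENNReal.ofReal_mul (by positivity)]
  have hKc : ∀ k l, k ≤ l → mixedNorm (p / 2) (q / 2) (fun z => v k z * v l z) ≤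
      K (l - k) * (c k * c l) := by
    intro k l hkl
    refine (mixedNorm_mul_le (by positivity) (by positivity) ha hb ha' hb' (hvm k) (hvm l)).trans ?_
    refine (mul_le_mul' (hvk h2p₁ h2q₁ hpq₁ k) (hvk h2p₂ h2q₂ hpq₂ l)).trans (le_of_eq ?_)
    rw [mul_mul_mul_comm, ← ENNReal.ofReal_mul (by positivity), hK]
    simp only
    rw [← ENNReal.ofReal_mul hD0]
    congr 2
    have hkl' : (0 : ℝ) ≤ (l : ℝ) - k := by
      have : (k : ℝ) ≤ l := by exact_mod_cast hkl
      linarith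
    push_cast
    rw [abs_of_nonneg hkl', hD]
    have e : (2 : ℝ) ^ (-k / p₁ : ℝ) * 2 ^ ((k + 1) * (1 / p) : ℝ) *
        (2 ^ (-l / p₂ : ℝ) * 2 ^ ((l + 1) * (1 / p) : ℝ)) =
        2 ^ (2 / p) * 2 ^ (-δ * ((l : ℝ) - k)) := by
      simp only [← Real.rpow_add zero_lt_two]
      congr 1
      rw [hp₁, hp₂, div_inv_eq_mul, div_inv_eq_mul]
      ring
    linear_combination (annConst p₁ q₁ * annConst p₂ q₂) * e
  have hmain := mixedNorm_tsum_rpow_two_le hp hq hvm hKc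
  have hcs : ∑' k, c k ^ (2 : ℝ) ≤ ∫⁻ w, ‖g w‖ₑ ^ (2 : ℝ) := by
    have : ∀ k, c k ^ (2 : ℝ) = ∫⁻ w in ann k, ‖g w‖ₑ ^ (2 : ℝ) := fun k => by
      rw [hc, ← ENNReal.rpow_mul]; norm_num
    simp_rw [this]
    rw [← lintegral_iUnion measurableSet_ann pairwise_disjoint_ann]
    exact setLIntegral_le_lintegral _ _
  calc _ ≤ mixedNorm p q (fun z => ∑' k, v k z) :=
        mixedNorm_mono (by linarith) (by linarith) (enorm_extension_le_tsum hGi)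
    _ = (mixedNorm p q (fun z => ∑' k, v k z) ^ (2 : ℝ)) ^ (1 / (2 : ℝ)) := by
        rw [← ENNReal.rpow_mul]; norm_num
    _ ≤ ((4 * ∑' m, K m) * ∫⁻ w, ‖g w‖ₑ ^ (2 : ℝ)) ^ (1 / (2 : ℝ)) := by
        gcongr
        exact hmain.trans (mul_le_mul_right hcs _)
    _ = (4 * ∑' m, K m) ^ (1 / (2 : ℝ)) * (∫⁻ w, ‖g w‖ₑ ^ (2 : ℝ)) ^ (1 / (2 : ℝ)) :=
        ENNReal.mul_rpow_of_nonneg _ _ (by norm_num)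
    _ ≤ _ := by
        gcongr
        refine (ENNReal.ofReal_toReal (ENNReal.rpow_ne_top_of_nonneg (by norm_num) hKtop)).symm.le.trans ?_
        exact ENNReal.ofReal_le_ofReal (by linarith)

lemma integral_real_prod_eq (F : ℝ × ℝ → ℂ) : ∫ v, F v = ∫ x : ℂ, F (x.re, x.im) :=
  (Complex.volume_preserving_equiv_real_prod.integral_comp'
    (f := Complex.measurableEquivRealProd) F).symm

lemma lintegral_real_prod_eq (F : ℝ × ℝ → ℝ≥0∞) : ∫⁻ v, F v = ∫⁻ x : ℂ, F (x.re, x.im) :=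
  (Complex.volume_preserving_equiv_real_prod.lintegral_comp_emb
    Complex.measurableEquivRealProd.measurableEmbedding F).symm

lemma FT2_eq_ft (u : ℝ × ℝ → ℂ) (w : ℂ) :
    FT2 u (w.re, w.im) = ft (fun x => u (x.re, x.im)) w := by
  rw [FT2, ft, integral_real_prod_eq]
  refine integral_congr_ae (ae_of_all _ fun x => ?_)
  simp only [wave, phase, Complex.neg_re, Complex.neg_im]
  congr 2
  push_cast
  ring

lemma rieszUphi_eq_extension (σ t : ℝ) (u : ℝ × ℝ → ℂ) (x : ℂ) :
    rieszUphi σ t u (x.re, x.im) = (2 * Real.pi : ℂ)⁻¹ ^ 2 *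
      extension (fun w => ((‖w‖ ^ σ : ℝ) : ℂ) * ft (fun y => u (y.re, y.im)) w) (t, x) := by
  rw [rieszUphi, extension, integral_real_prod_eq]
  congr 1
  refine integral_congr_ae (ae_of_all _ fun w => ?_)
  simp only [FT2_eq_ft, wave, phase, mul_assoc]
  congr 2
  · push_cast
    ring
  · rw [Complex.norm_eq_sqrt_sq_add_sq]

lemma extension_eq_zero_of_not_integrable {H : ℂ → ℂ} (hH : ¬ Integrable H) (z : ℝ × ℂ) :
    extension H z = 0 := by
  refine integral_undef fun h => hH ?_
  have h' := h.bdd_mul (c := 1) (f := fun w => wave (-z.1) (-z.2) w)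
    (measurable_wave_right _ _).aestronglyMeasurable (ae_of_all _ fun _ => (norm_wave ..).le)
  refine h'.congr (ae_of_all _ fun w => ?_)
  simp only
  rw [← mul_assoc, ← wave_add]
  simp [wave, phase]

lemma norm_two_pi_inv_sq_le_one : ‖(2 * Real.pi : ℂ)⁻¹ ^ 2‖ₑ ≤ 1 := by
  rw [← ofReal_norm, ENNReal.ofReal_le_one]
  have h : ‖(2 * Real.pi : ℂ)⁻¹‖ ≤ 1 := by
    rw [norm_inv]
    refine inv_le_one_of_one_le₀ ?_
    rw [norm_mul, Complex.norm_real, Real.norm_of_nonneg Real.pi_pos.le, Complex.norm_ofNat]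
    linarith [Real.pi_gt_three]
  rw [norm_pow]
  exact pow_le_one₀ (norm_nonneg _) h

theorem exists_lintegral_rieszUphi_le {p q : ℝ} (hp : 2 < p) (hpq : 2 / p + 2 / q = 1) :
    ∃ C > (0 : ℝ), ∀ u : SchwartzMap (ℝ × ℝ) ℂ,
      (∫⁻ t : ℝ, (∫⁻ v : ℝ × ℝ, ‖rieszUphi (1 / p) t u v‖ₑ ^ q) ^ (p / q)) ^ (1 / p) ≤
        ENNReal.ofReal C * (∫⁻ v : ℝ × ℝ, ‖u v‖ₑ ^ (2 : ℝ)) ^ (1 / (2 : ℝ)) := by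
  have hp0 : 0 < p := by linarith
  have hq : 2 < q := by
    have h1 : 2 / p < 1 := (div_lt_one hp0).2 hp
    have h2 : 0 < 2 / p := by positivity
    have h3 : 0 < q := by
      by_contra h
      have := div_nonpos_of_nonneg_of_nonpos zero_le_two (not_lt.1 h)
      linarith
    exact (div_lt_one h3).1 (by linarith)
  have hq0 : 0 < q := by linarith
  obtain ⟨C, hC, h⟩ := exists_mixedNorm_extension_le hp hq hpq
  refine ⟨C * (2 * Real.pi), by positivity, fun u => ?_⟩
  set f : ℂ → ℂ := fun x => u (x.re, x.im) with hf
  have hfc : Continuous f := by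
    have := u.continuous
    fun_prop
  have hmp := Complex.volume_preserving_equiv_real_prod
  have hf1 : Integrable f := (hmp.integrable_comp_emb
    Complex.measurableEquivRealProd.measurableEmbedding).2 (u.integrable (μ := volume))
  have hf2 : MemLp f 2 := (u.memLp 2 volume).comp_measurePreserving hmp
  set G : ℂ → ℂ := fun w => ((‖w‖ ^ (1 / p) : ℝ) : ℂ) * ft f w with hG
  have hle : (∫⁻ t : ℝ, (∫⁻ v : ℝ × ℝ, ‖rieszUphi (1 / p) t u v‖ₑ ^ q) ^ (p / q)) ^ (1 / p) ≤
      mixedNorm p q (fun z => ‖extension G z‖ₑ) := by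
    simp_rw [lintegral_real_prod_eq, rieszUphi_eq_extension, enorm_mul]
    refine mixedNorm_mono hp0 hq0
      (F := fun z => ‖(2 * Real.pi : ℂ)⁻¹ ^ 2‖ₑ * ‖extension G z‖ₑ) fun z => ?_
    exact mul_le_of_le_one_left' norm_two_pi_inv_sq_le_one
  refine hle.trans ?_
  by_cases hGi : Integrable G
  · refine (h (ft f) (stronglyMeasurable_ft hfc.measurable).measurable hGi).trans (le_of_eq ?_)
    rw [lintegral_ft hf1 hf2, ENNReal.mul_rpow_of_nonneg _ _ (by norm_num : (0 : ℝ) ≤ 1 / 2),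
      ENNReal.ofReal_rpow_of_nonneg (by positivity) (by norm_num), ← mul_assoc,
      ← ENNReal.ofReal_mul hC.le, ← Real.sqrt_eq_rpow, Real.sqrt_sq (by positivity),
      lintegral_real_prod_eq]
  · simp only [extension_eq_zero_of_not_integrable hGi, mixedNorm, enorm_zero,
      ENNReal.zero_rpow_of_pos hq0, lintegral_zero, ENNReal.zero_rpow_of_pos (div_pos hp0 hq0),
      ENNReal.zero_rpow_of_pos (one_div_pos.2 hp0)]
    exact zero_le

end NovikovVeselov

/-- Strichartz estimate with derivative gain for the linearized Novikov-Veselov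
equation: `‖I^{1/p} U_φ u₀‖_{L^p_t L^q_{xy}} ≲ ‖u₀‖_{L²}` for `p > 2`, `2/p + 2/q = 1`. -/
theorem strichartz_NV_gain (p q : ℝ) (hp : 2 < p) (hpq : 2 / p + 2 / q = 1) :
    ∃ C > (0 : ℝ), ∀ u₀ : SchwartzMap (ℝ × ℝ) ℂ,
      (∫⁻ t : ℝ, (∫⁻ v : ℝ × ℝ, (‖rieszUphi (1 / p) t u₀ v‖₊ : ENNReal) ^ q) ^ (p / q))
          ^ (1 / p)
        ≤ ENNReal.ofReal C *
          (∫⁻ v : ℝ × ℝ, (‖u₀ v‖₊ : ENNReal) ^ (2 : ℝ)) ^ ((1 : ℝ) / 2) :=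
  NovikovVeselov.exists_lintegral_rieszUphi_le hp hpq
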